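/- Fix K > 1. There exists a constant C_K > 0 depending only on K such that for all n = m_1 + m_2 and every dimension d (possibly depending on n), sup_{P ∈ 𝒫_{0,n}} sup_{z ∈ ℝ} | P_P( T_mean ≤ z ) − Φ(z) | ≤ C_K / √m_1, where 𝒫_{0,n} is the class of distributions on ℝ^d satisfying Assumption 1 with mean μ = 0 and constant K, and X_1,…,X_n are i.i.d. from P. -/

import Mathlib

/-!
Statement 1: Unconditional uniform Berry–Esseen bound for the studentized cross mean
statistic `T_mean` (Theorem 2 of Kim & Ramdas).  For every `K > 1` there is a constant
`C_K > 0` depending only on `K` such that, uniformly over the class `𝒫_{0,n}` of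
distributions on `ℝ^d` satisfying the Lyapunov-ratio Assumption 1 with mean `0` and
constant `K`, and for every dimension `d` and split sizes `m₁, m₂`,
`sup_z |P(T_mean ≤ z) − Φ(z)| ≤ C_K/√m₁`.
-/

open MeasureTheory ProbabilityTheory Filter

noncomputable section

/-- Euclidean dot product on `Fin d → ℝ`. -/
def dot {d : ℕ} (x y : Fin d → ℝ) : ℝ := ∑ i, x i * y i

/-- Studentized statistic `√m · ȳ / sqrt(m⁻¹ ∑ (yᵢ − ȳ)²)` of a sample of reals. -/
def studentized (m : ℕ) (y : Fin m → ℝ) : ℝ :=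
  Real.sqrt m * ((∑ i, y i) / m) /
    Real.sqrt ((∑ i, (y i - (∑ j, y j) / m) ^ 2) / m)

/-- Standard normal cumulative distribution function. -/
def Φ (z : ℝ) : ℝ := ∫ t in Set.Iic z, Real.exp (-t ^ 2 / 2) / Real.sqrt (2 * Real.pi)

/-- The studentized cross mean statistic: `μ̂₂` is the sample mean of the second half,
`f_mean(x) = μ̂₂ᵀx`, and we studentize `f_mean` over the first half. -/
def Tmean (d m₁ m₂ : ℕ) (ω : Fin (m₁ + m₂) → Fin d → ℝ) : ℝ :=
  studentized m₁ fun i =>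
    dot (fun j => (∑ k : Fin m₂, ω (Fin.natAdd m₁ k) j) / m₂) (ω (Fin.castAdd m₂ i))

/-- Assumption 1 (Lyapunov ratio): `P` is a continuous probability distribution on `ℝ^d`
with mean `μv`, and for every unit vector `u`,
`(E|uᵀ(X−μ)|³)^{1/3} ≤ K·(E|uᵀ(X−μ)|²)^{1/2}`. -/
def LyapunovAssumption {d : ℕ} (P : Measure (Fin d → ℝ)) (μv : Fin d → ℝ) (K : ℝ) : Prop :=
  IsProbabilityMeasure P ∧
  (∀ x, P {x} = 0) ∧
  (∀ i, Integrable (fun x => x i) P) ∧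
  (∀ i, ∫ x, x i ∂P = μv i) ∧
  ∀ u : Fin d → ℝ, dot u u = 1 →
    Integrable (fun x => |dot u (fun j => x j - μv j)| ^ 3) P ∧
    (∫ x, |dot u (fun j => x j - μv j)| ^ 3 ∂P) ^ ((1 : ℝ) / 3) ≤
      K * (∫ x, dot u (fun j => x j - μv j) ^ 2 ∂P) ^ ((1 : ℝ) / 2)

lemma gexp_integrable : Integrable (fun t : ℝ => Real.exp (-t ^ 2 / 2)) := by
  have := integrable_exp_neg_mul_sq (b := (1/2 : ℝ)) (by norm_num)
  refine this.congr (ae_of_all _ fun t => ?_)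
  simp only; congr 1; ring

lemma gexp_integral : ∫ t : ℝ, Real.exp (-t ^ 2 / 2) = Real.sqrt (2 * Real.pi) := by
  have := integral_gaussian (1/2 : ℝ)
  rw [show Real.pi / (1/2) = 2 * Real.pi by ring] at this
  rw [← this]; congr 1; ext t; congr 1; ring

lemma sqrt_two_pi_le : Real.sqrt (2 * Real.pi) ≤ 3 := by
  rw [Real.sqrt_le_left (by norm_num)]; nlinarith [Real.pi_lt_d2]

lemma two_le_sqrt_two_pi : 2 ≤ Real.sqrt (2 * Real.pi) := by
  apply Real.le_sqrt_of_sq_le; nlinarith [Real.pi_gt_three]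

lemma phi_integrable :
    Integrable (fun t : ℝ => Real.exp (-t ^ 2 / 2) / Real.sqrt (2 * Real.pi)) :=
  gexp_integrable.div_const _

lemma phi_integral : ∫ t : ℝ, Real.exp (-t ^ 2 / 2) / Real.sqrt (2 * Real.pi) = 1 := by
  rw [integral_div, gexp_integral, div_self]
  have := two_le_sqrt_two_pi; positivity

lemma phi_nonneg (t : ℝ) : 0 ≤ Real.exp (-t ^ 2 / 2) / Real.sqrt (2 * Real.pi) := by positivity

lemma Phi_nonneg (z : ℝ) : 0 ≤ Φ z := integral_nonneg phi_nonneg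

lemma Phi_le_one (z : ℝ) : Φ z ≤ 1 := by
  rw [← phi_integral]
  exact setIntegral_le_integral phi_integrable (ae_of_all _ phi_nonneg)

lemma Phi_mono : Monotone Φ := by
  intro a b hab
  exact setIntegral_mono_set phi_integrable.integrableOn (ae_of_all _ phi_nonneg)
    (Set.Iic_subset_Iic.2 hab).eventuallyLE

lemma Phi_sub (a b : ℝ) :
    Φ b - Φ a = ∫ t in a..b, Real.exp (-t ^ 2 / 2) / Real.sqrt (2 * Real.pi) := by
  unfold Φ
  exact intervalIntegral.integral_Iic_sub_Iic phi_integrable.integrableOn phi_integrable.integrableOn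

lemma phi_weight (w : ℝ) :
    (1 + |w|) * (Real.exp (-w ^ 2 / 2) / Real.sqrt (2 * Real.pi)) ≤ 1 := by
  have h1 : Real.exp (-w ^ 2 / 2) * (1 + w ^ 2 / 2) ≤ 1 := by
    have := Real.add_one_le_exp (w ^ 2 / 2)
    calc Real.exp (-w ^ 2 / 2) * (1 + w ^ 2 / 2)
        ≤ Real.exp (-w ^ 2 / 2) * Real.exp (w ^ 2 / 2) := by gcongr; linarith
      _ = 1 := by rw [← Real.exp_add]; simp [neg_div]
  have h2 := two_le_sqrt_two_pi
  rw [mul_div_assoc', div_le_one (by linarith)]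
  have h3 : 1 + |w| ≤ 2 * (1 + w ^ 2 / 2) := by
    nlinarith [sq_abs w, sq_nonneg (|w| - 1), abs_nonneg w]
  have := Real.exp_pos (-w ^ 2 / 2)
  nlinarith

lemma Phi_close (x y κ : ℝ) (hκ : κ ≤ 1 / 2) (hy : |y - x| ≤ κ * (1 + |x|)) :
    |Φ y - Φ x| ≤ 2 * κ := by
  rw [Phi_sub, ← Real.norm_eq_abs]
  have hκ0 : 0 ≤ κ := by
    by_contra h
    have : κ * (1 + |x|) < 0 := mul_neg_of_neg_of_pos (not_le.1 h) (by positivity)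
    linarith [abs_nonneg (y - x)]
  have key : ∀ w ∈ Set.uIoc x y,
      ‖Real.exp (-w ^ 2 / 2) / Real.sqrt (2 * Real.pi)‖ ≤ 2 / (1 + |x|) := by
    intro w hw
    rw [Real.norm_of_nonneg (phi_nonneg w), le_div_iff₀ (by positivity)]
    have hw' : |w - x| ≤ |y - x| := Set.abs_sub_left_of_mem_uIcc (Set.uIoc_subset_uIcc hw)
    have h1 : |x| ≤ |w| + |w - x| := by
      have := abs_sub_abs_le_abs_sub x w
      rw [abs_sub_comm x w] at this; linarith
    have h2 : κ * (1 + |x|) ≤ 1 / 2 * (1 + |x|) := by gcongr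
    have h3 := phi_weight w
    have h4 := phi_nonneg w
    nlinarith
  refine (intervalIntegral.norm_integral_le_of_norm_le_const key).trans ?_
  rw [div_mul_eq_mul_div, div_le_iff₀ (by positivity)]
  nlinarith

/-- Mills ratio type bounds. -/
lemma mills1 (w : ℝ) (hw : 0 ≤ w) :
    ∫ t in Set.Ioi w, Real.exp (-t ^ 2 / 2) ≤ 3 * Real.exp (-w ^ 2 / 2) := by
  have e : ∫ t in Set.Ioi w, Real.exp (-t ^ 2 / 2)
      = ∫ s in Set.Ioi (0:ℝ), Real.exp (-(s + w) ^ 2 / 2) := by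
    have := (measurePreserving_add_right (volume : Measure ℝ) w).setIntegral_preimage_emb
      (measurableEmbedding_addRight w) (fun t : ℝ => Real.exp (-t ^ 2 / 2)) (Set.Ioi w)
    rw [← this]; simp
  rw [e]
  calc ∫ s in Set.Ioi (0:ℝ), Real.exp (-(s + w) ^ 2 / 2)
      ≤ ∫ s in Set.Ioi (0:ℝ), Real.exp (-w ^ 2 / 2) * Real.exp (-s ^ 2 / 2) := by
        apply setIntegral_mono_on
        · exact (gexp_integrable.comp_add_right w).integrableOn
        · exact (gexp_integrable.const_mul _).integrableOn
        · exact measurableSet_Ioi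
        · intro s hs
          rw [← Real.exp_add]
          apply Real.exp_le_exp.2
          have : 0 ≤ s * w := mul_nonneg (le_of_lt hs) hw
          nlinarith
    _ = Real.exp (-w ^ 2 / 2) * ∫ s in Set.Ioi (0:ℝ), Real.exp (-s ^ 2 / 2) := by
        rw [integral_const_mul]
    _ ≤ Real.exp (-w ^ 2 / 2) * 3 := by
        gcongr
        refine le_trans (setIntegral_le_integral gexp_integrable
          (ae_of_all _ fun t => (Real.exp_pos _).le)) ?_
        rw [gexp_integral]; exact sqrt_two_pi_le
    _ = _ := by ring

lemma mills2 (w : ℝ) (hw : 0 ≤ w) :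
    w * ∫ t in Set.Ioi w, Real.exp (-t ^ 2 / 2) ≤ Real.exp (-w ^ 2 / 2) := by
  have hint : Integrable (fun t : ℝ => t * Real.exp (-t ^ 2 / 2)) := by
    have := integrable_mul_exp_neg_mul_sq (b := (1/2 : ℝ)) (by norm_num)
    refine this.congr (ae_of_all _ fun t => ?_)
    simp only; congr 2; ring
  have hd : ∀ t ∈ Set.Ici w, HasDerivAt (fun t : ℝ => -Real.exp (-t ^ 2 / 2))
      (t * Real.exp (-t ^ 2 / 2)) t := by
    intro t _
    have h1 : HasDerivAt (fun t : ℝ => -t ^ 2 / 2) (-t) t := by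
      have := ((hasDerivAt_id t).pow 2).neg.div_const 2
      convert! this using 1
      simp; try ring
    convert! h1.exp.neg using 1; ring
  have hlim : Tendsto (fun t : ℝ => -Real.exp (-t ^ 2 / 2)) atTop (nhds 0) := by
    rw [← neg_zero]
    apply Tendsto.neg
    apply Real.tendsto_exp_atBot.comp
    have : Tendsto (fun t : ℝ => t ^ 2 / 2) atTop atTop :=
      (tendsto_pow_atTop (by norm_num)).atTop_div_const (by norm_num)
    convert tendsto_neg_atTop_atBot.comp this using 1
    ext t; simp [neg_div]
  have := integral_Ioi_of_hasDerivAt_of_tendsto' hd hint.integrableOn hlim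
  rw [zero_sub, neg_neg] at this
  rw [← this, ← integral_const_mul]
  apply setIntegral_mono_on (gexp_integrable.const_mul _).integrableOn hint.integrableOn
    measurableSet_Ioi
  intro t ht
  have : w ≤ t := le_of_lt ht
  gcongr

lemma gexp_Iic (w : ℝ) :
    ∫ t in Set.Iic w, Real.exp (-t ^ 2 / 2) = ∫ t in Set.Ioi (-w), Real.exp (-t ^ 2 / 2) := by
  rw [← integral_comp_neg_Iic w (fun t => Real.exp (-t ^ 2 / 2))]
  simp

/-- Solution of the Stein equation. -/
lemma stein_exists (h : ℝ → ℝ) (hc : Continuous h) (h0 : ∀ w, 0 ≤ h w) (h1 : ∀ w, h w ≤ 1) :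
    ∃ f : ℝ → ℝ,
      (∀ w, HasDerivAt f
        (w * f w + h w - ∫ t, h t * (Real.exp (-t ^ 2 / 2) / Real.sqrt (2 * Real.pi))) w) ∧
      (∀ w, |f w| ≤ 3) ∧ (∀ w, |w * f w| ≤ 1) := by
  set c := ∫ t, h t * (Real.exp (-t ^ 2 / 2) / Real.sqrt (2 * Real.pi)) with hcdef
  have hs := two_le_sqrt_two_pi
  have hgm : ∀ g : ℝ → ℝ, Continuous g → (∀ w, |g w| ≤ 1) →
      Integrable (fun t : ℝ => g t * Real.exp (-t ^ 2 / 2)) := by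
    intro g hg hb
    refine gexp_integrable.mono (by fun_prop) (ae_of_all _ fun t => ?_)
    rw [norm_mul]
    exact mul_le_of_le_one_left (norm_nonneg _) (hb t)
  have hhi := hgm h hc (fun w => abs_le.2 ⟨by linarith [h0 w], h1 w⟩)
  have hceq : c * Real.sqrt (2 * Real.pi) = ∫ t, h t * Real.exp (-t ^ 2 / 2) := by
    rw [hcdef, ← integral_mul_const]
    congr 1; ext t; field_simp
  have hc0 : 0 ≤ c := integral_nonneg fun t => mul_nonneg (h0 t) (phi_nonneg t)
  have hc1 : c ≤ 1 := by
    have : c * Real.sqrt (2 * Real.pi) ≤ Real.sqrt (2 * Real.pi) := by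
      rw [hceq, ← gexp_integral]
      apply integral_mono hhi gexp_integrable
      intro t
      exact mul_le_of_le_one_left (Real.exp_pos _).le (h1 t)
    nlinarith
  set k : ℝ → ℝ := fun t => (h t - c) * Real.exp (-t ^ 2 / 2) with hk
  have hkc : Continuous k := by fun_prop
  have hki : Integrable k := hgm (fun t => h t - c) (by fun_prop)
    (fun w => abs_le.2 ⟨by linarith [h0 w], by linarith [h1 w]⟩)
  have hkz : ∫ t, k t = 0 := by
    have : k = fun t => h t * Real.exp (-t ^ 2 / 2) - c * Real.exp (-t ^ 2 / 2) := by
      ext t; simp only [hk]; ring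
    rw [this, integral_sub hhi (gexp_integrable.const_mul c), integral_const_mul, gexp_integral,
      hceq, sub_self]
  have hkb : ∀ t, ‖k t‖ ≤ Real.exp (-t ^ 2 / 2) := by
    intro t
    simp only [hk, norm_mul]
    rw [Real.norm_of_nonneg (Real.exp_pos _).le]
    apply mul_le_of_le_one_left (Real.exp_pos _).le
    exact abs_le.2 ⟨by linarith [h0 t], by linarith [h1 t]⟩
  set F : ℝ → ℝ := fun w => ∫ t in Set.Iic w, k t with hF
  have hFd : ∀ w, HasDerivAt F (k w) w := by
    intro w
    have e : F = fun w => F 0 + ∫ t in (0:ℝ)..w, k t := by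
      ext w
      have := intervalIntegral.integral_Iic_sub_Iic (a := 0) (b := w) hki.integrableOn hki.integrableOn
      simp only [hF]; linarith
    rw [e]
    exact (intervalIntegral.integral_hasDerivAt_right (hkc.intervalIntegrable _ _)
      (hkc.stronglyMeasurableAtFilter _ _) hkc.continuousAt).const_add _
  -- bounds on F
  have hFb : ∀ w, |F w| ≤ ∫ t in Set.Ioi |w|, Real.exp (-t ^ 2 / 2) := by
    intro w
    rcases le_total 0 w with hw | hw
    · rw [abs_of_nonneg hw]
      have : F w = - ∫ t in Set.Ioi w, k t := by
        have := intervalIntegral.integral_Iic_add_Ioi (b := w) hki.integrableOn hki.integrableOn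
        rw [hkz] at this
        simp only [hF]; linarith
      rw [this, abs_neg]
      exact norm_integral_le_of_norm_le gexp_integrable.integrableOn (ae_of_all _ hkb)
    · rw [abs_of_nonpos hw, ← gexp_Iic]
      exact norm_integral_le_of_norm_le gexp_integrable.integrableOn (ae_of_all _ hkb)
  have hee : ∀ w : ℝ, Real.exp (w ^ 2 / 2) * Real.exp (-w ^ 2 / 2) = 1 := by
    intro w; rw [← Real.exp_add]; simp [neg_div]
  refine ⟨fun w => Real.exp (w ^ 2 / 2) * F w, ?_, ?_, ?_⟩
  · intro w
    have h1 : HasDerivAt (fun t : ℝ => Real.exp (t ^ 2 / 2)) (Real.exp (w ^ 2 / 2) * w) w := by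
      have h2 : HasDerivAt (fun t : ℝ => t ^ 2 / 2) w w := by
        have := ((hasDerivAt_id w).pow 2).div_const 2
        convert! this using 1
        simp
      exact h2.exp
    convert! h1.mul (hFd w) using 1
    have := hee w
    simp only [hk]
    linear_combination (-(h w - c)) * this
  · intro w
    have m := mills1 |w| (abs_nonneg w)
    rw [sq_abs] at m
    rw [abs_mul, abs_of_pos (Real.exp_pos _)]
    calc Real.exp (w ^ 2 / 2) * |F w| ≤ Real.exp (w ^ 2 / 2) * (3 * Real.exp (-w ^ 2 / 2)) := by
          gcongr; exact (hFb w).trans m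
      _ = 3 := by linear_combination 3 * hee w
  · intro w
    have m := mills2 |w| (abs_nonneg w)
    rw [sq_abs] at m
    rw [abs_mul, abs_mul, abs_of_pos (Real.exp_pos _)]
    calc |w| * (Real.exp (w ^ 2 / 2) * |F w|) = Real.exp (w ^ 2 / 2) * (|w| * |F w|) := by ring
      _ ≤ Real.exp (w ^ 2 / 2) * (Real.exp (-w ^ 2 / 2)) := by
          gcongr
          exact le_trans (mul_le_mul_of_nonneg_left (hFb w) (abs_nonneg w)) m
      _ = 1 := hee w


/-- Regularised self-normaliser. -/
def Ureg (q : ℝ) : ℝ := Real.sqrt (max q (1 / 4))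

lemma Ureg_sq (q : ℝ) : Ureg q ^ 2 = max q (1 / 4) :=
  Real.sq_sqrt (le_trans (by norm_num) (le_max_right _ _))

lemma Ureg_half (q : ℝ) : 1 / 2 ≤ Ureg q := by
  apply Real.le_sqrt_of_sq_le
  exact le_trans (by norm_num) (le_max_right _ _)

lemma Ureg_mono : Monotone Ureg := fun _ _ h => Real.sqrt_le_sqrt (max_le_max h le_rfl)

@[fun_prop]
lemma Ureg_measurable : Measurable Ureg := by unfold Ureg; fun_prop

lemma Ureg_facts (B t : ℝ) (hB : 0 ≤ B) :
    Ureg B ≤ Ureg (t ^ 2 + B) ∧ |t| ≤ Ureg (t ^ 2 + B) ∧ Ureg (t ^ 2 + B) ≤ Ureg B + |t| ∧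
      Ureg (t ^ 2 + B) ^ 2 - Ureg B ^ 2 ≤ t ^ 2 := by
  have h4 : Ureg (t ^ 2 + B) ^ 2 - Ureg B ^ 2 ≤ t ^ 2 := by
    rw [Ureg_sq, Ureg_sq]
    have : max (t ^ 2 + B) (1/4) ≤ t ^ 2 + max B (1/4) := by
      apply max_le
      · linarith [le_max_left B (1/4)]
      · linarith [le_max_right B (1/4), sq_nonneg t]
    linarith
  have ha := Ureg_half B
  have hb := Ureg_half (t ^ 2 + B)
  refine ⟨Ureg_mono (by nlinarith [sq_nonneg t]), ?_, ?_, h4⟩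
  · apply abs_le_of_sq_le_sq _ (by linarith)
    rw [Ureg_sq]; exact le_trans (by linarith) (le_max_left _ _)
  · have := abs_nonneg t
    apply le_of_sq_le_sq _ (by linarith)
    nlinarith [sq_abs t]

set_option maxHeartbeats 1000000 in
lemma pointwise_stein (f h : ℝ → ℝ) (c a b t A : ℝ)
    (hf : ∀ w, HasDerivAt f (w * f w + h w - c) w) (hf3 : ∀ w, |f w| ≤ 3)
    (hf2 : ∀ w, |w * f w + h w - c| ≤ 2)
    (ha : 1 / 2 ≤ a) (hab : a ≤ b) (htb : |t| ≤ b) (hbat : b ≤ a + |t|)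
    (hsq : b ^ 2 - a ^ 2 ≤ t ^ 2) :
    ∃ τ ∈ Set.uIcc (A / a) ((t + A) / b),
      |t ^ 2 * ((t + A) / b * f ((t + A) / b) + h ((t + A) / b) - c) / b ^ 2
        - t * (f ((t + A) / b) / b - f (A / a) / a)|
      ≤ 240 * |t| ^ 3 * (1 + A ^ 2) + 4 * t ^ 2 * |h ((t + A) / b) - h τ| := by
  have hb : 1 / 2 ≤ b := ha.trans hab
  have ha0 : 0 < a := by linarith
  have hb0 : 0 < b := by linarith
  set X := (t + A) / b with hX
  set Y := A / a with hY
  set f' : ℝ → ℝ := fun w => w * f w + h w - c with hf'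
  have hlip : ∀ p q, |f p - f q| ≤ 2 * |p - q| := by
    intro p q
    exact Convex.norm_image_sub_le_of_norm_hasDerivWithin_le (f := f) (f' := f') (C := 2)
      (s := Set.univ) (fun w _ => (hf w).hasDerivWithinAt) (fun w _ => hf2 w) convex_univ
      (Set.mem_univ q) (Set.mem_univ p)
  obtain ⟨τ, hτ, hmv⟩ : ∃ τ ∈ Set.uIcc Y X, f X - f Y = f' τ * (X - Y) := by
    have hcont : Continuous f := continuous_iff_continuousAt.2 fun w => (hf w).continuousAt
    rcases lt_trichotomy Y X with hlt | heq | hgt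
    · obtain ⟨τ, hτ, e⟩ := exists_hasDerivAt_eq_slope f f' hlt hcont.continuousOn
        (fun w _ => hf w)
      refine ⟨τ, by rw [Set.uIcc_of_le hlt.le]; exact Set.Ioo_subset_Icc_self hτ, ?_⟩
      rw [e]; field_simp [sub_ne_zero.2 hlt.ne']
    · exact ⟨Y, Set.left_mem_uIcc, by rw [heq]; ring⟩
    · obtain ⟨τ, hτ, e⟩ := exists_hasDerivAt_eq_slope f f' hgt hcont.continuousOn
        (fun w _ => hf w)
      refine ⟨τ, by rw [Set.uIcc_of_ge hgt.le]; exact Set.Ioo_subset_Icc_self hτ, ?_⟩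
      rw [e]
      have : Y - X ≠ 0 := sub_ne_zero.2 hgt.ne'
      field_simp; ring
  refine ⟨τ, hτ, ?_⟩
  have hbX : b * X = t + A := by rw [hX]; field_simp
  have haY : a * Y = A := by rw [hY]; field_simp
  have hinva : 1 / a ≤ 2 := by rw [div_le_iff₀ ha0]; linarith
  have hinvb : 1 / b ≤ 2 := by rw [div_le_iff₀ hb0]; linarith
  have hba : b - a ≤ t ^ 2 := by nlinarith
  -- |X| bound
  have hXb : |X| ≤ 2 * |A| + 1 := by
    rw [hX, abs_div, abs_of_pos hb0, div_le_iff₀ hb0]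
    have := abs_add_le t A
    nlinarith [abs_nonneg A]
  have hXY : X - Y = t / a + X * (a - b) / a := by
    field_simp; linear_combination hbX - haY
  have hXYb : |X - Y| ≤ 2 * |t| * (1 + |X|) := by
    have : X - Y = (t + X * (a - b)) / a := by rw [hXY]; ring
    rw [this, abs_div, abs_of_pos ha0, div_le_iff₀ ha0]
    have h1 : |t + X * (a - b)| ≤ |t| + |X| * |t| := by
      refine (abs_add_le _ _).trans ?_
      rw [abs_mul]
      refine add_le_add_right (mul_le_mul_of_nonneg_left ?_ (abs_nonneg _)) _
      rw [abs_le]; constructor <;> linarith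
    have : 0 ≤ |t| * (1 + |X|) := by positivity
    nlinarith
  -- decomposition
  have e1 : t * f' X / b ^ 2 - (f X / b - f Y / a)
      = t / b ^ 2 * (f' X - f' τ) + f' τ * (t / b ^ 2 - t / a ^ 2)
        - f' τ * (X * (a - b) / a ^ 2) - f X * (1 / b - 1 / a) := by
    have h1 : f Y = f X - f' τ * (t / a + X * (a - b) / a) := by rw [← hXY, ← hmv]; ring
    rw [h1]; field_simp; ring
  have b1 : |1 / b - 1 / a| ≤ 4 * t ^ 2 := by
    have : 1 / b - 1 / a = -((b - a) * (1 / a) * (1 / b)) := by field_simp; ring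
    rw [this, abs_neg, abs_of_nonneg (by have : 0 ≤ b - a := by linarith
                                         positivity)]
    calc (b - a) * (1 / a) * (1 / b) ≤ t ^ 2 * 2 * 2 := by gcongr
      _ = _ := by ring
  have b2 : |t / b ^ 2 - t / a ^ 2| ≤ 8 * t ^ 2 := by
    have : t / b ^ 2 - t / a ^ 2 = -(t / b * (1 / b) * (1 / a) ^ 2 * (b ^ 2 - a ^ 2)) := by
      field_simp; ring
    have hnn : 0 ≤ b ^ 2 - a ^ 2 := by nlinarith
    have htb' : |t / b| ≤ 1 := by rw [abs_div, abs_of_pos hb0, div_le_one hb0]; exact htb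
    rw [this, abs_neg, abs_mul, abs_mul, abs_mul, abs_of_nonneg hnn,
      abs_of_nonneg (by positivity : 0 ≤ 1 / b), abs_of_nonneg (by positivity : 0 ≤ (1 / a) ^ 2)]
    calc |t / b| * (1 / b) * (1 / a) ^ 2 * (b ^ 2 - a ^ 2) ≤ 1 * 2 * 2 ^ 2 * t ^ 2 := by gcongr
      _ = _ := by ring
  have b3 : |X * (a - b) / a ^ 2| ≤ 4 * t ^ 2 * |X| := by
    have : X * (a - b) / a ^ 2 = -(X * (b - a) * (1 / a) ^ 2) := by field_simp; ring
    rw [this, abs_neg, abs_mul, abs_mul, abs_of_nonneg (by linarith : 0 ≤ b - a),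
      abs_of_nonneg (by positivity : 0 ≤ (1 / a) ^ 2)]
    calc |X| * (b - a) * (1 / a) ^ 2 ≤ |X| * t ^ 2 * 2 ^ 2 := by gcongr
      _ = _ := by ring
  have b4 : |t / b ^ 2| ≤ 4 * |t| := by
    have : t / b ^ 2 = t * (1 / b) ^ 2 := by field_simp
    rw [this, abs_mul, abs_of_nonneg (by positivity : 0 ≤ (1 / b) ^ 2)]
    calc |t| * (1 / b) ^ 2 ≤ |t| * 2 ^ 2 := by gcongr
      _ = _ := by ring
  have hXτ : |X - τ| ≤ |X - Y| := Set.abs_sub_right_of_mem_uIcc hτ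
  have b5 : |f' X - f' τ| ≤ 48 * |t| * (1 + A ^ 2) + |h X - h τ| := by
    have : f' X - f' τ = (X * (f X - f τ) + (X - τ) * f τ) + (h X - h τ) := by
      simp only [hf']; ring
    rw [this]
    refine (abs_add_le _ _).trans ?_
    gcongr
    refine (abs_add_le _ _).trans ?_
    rw [abs_mul, abs_mul]
    have q1 : |X| * |f X - f τ| ≤ |X| * (2 * |X - τ|) := by gcongr; exact hlip _ _
    have q2 : |X - τ| * |f τ| ≤ |X - τ| * 3 := by gcongr; exact hf3 _
    have q3 : |X - τ| ≤ 2 * |t| * (1 + |X|) := hXτ.trans hXYb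
    have q4 : |X| * (2 * |X - τ|) + |X - τ| * 3 ≤ 2 * |t| * (1 + |X|) * (3 * (1 + |X|)) := by
      calc |X| * (2 * |X - τ|) + |X - τ| * 3 = |X - τ| * (2 * |X| + 3) := by ring
        _ ≤ 2 * |t| * (1 + |X|) * (3 * (1 + |X|)) := by
          gcongr; linarith [abs_nonneg X]
    have q5 : (1 + |X|) ^ 2 ≤ 8 * (1 + A ^ 2) := by
      have : (1 + |X|) ^ 2 ≤ (2 * (1 + |A|)) ^ 2 := by
        gcongr; linarith
      nlinarith [sq_nonneg (|A| - 1), sq_abs A]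
    have q6 : |t| * (1 + |X|) ^ 2 ≤ |t| * (8 * (1 + A ^ 2)) := by gcongr
    linarith
  have e2 : t ^ 2 * (X * f X + h X - c) / b ^ 2 - t * (f X / b - f Y / a)
      = t * (t * f' X / b ^ 2 - (f X / b - f Y / a)) := by simp only [hf']; ring
  rw [e2, abs_mul]
  have hA1 : |X| ≤ 2 * (1 + A ^ 2) := by nlinarith [sq_nonneg (|A| - 1), sq_abs A]
  have tot : |t * f' X / b ^ 2 - (f X / b - f Y / a)|
      ≤ 240 * t ^ 2 * (1 + A ^ 2) + 4 * |t| * |h X - h τ| := by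
    rw [e1]
    have p1 : |t / b ^ 2 * (f' X - f' τ)| ≤ 4 * |t| * (48 * |t| * (1 + A ^ 2) + |h X - h τ|) := by
      rw [abs_mul]; gcongr
    have p2 : |f' τ * (t / b ^ 2 - t / a ^ 2)| ≤ 2 * (8 * t ^ 2) := by
      rw [abs_mul]; gcongr; exact hf2 τ
    have p3 : |f' τ * (X * (a - b) / a ^ 2)| ≤ 2 * (4 * t ^ 2 * (2 * (1 + A ^ 2))) := by
      rw [abs_mul]; gcongr
      · exact hf2 τ
      · exact b3.trans (by gcongr)
    have p4 : |f X * (1 / b - 1 / a)| ≤ 3 * (4 * t ^ 2) := by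
      rw [abs_mul]; gcongr; exact hf3 X
    have r1 := abs_add_le (t / b ^ 2 * (f' X - f' τ)) (f' τ * (t / b ^ 2 - t / a ^ 2))
    have r2 := abs_sub (t / b ^ 2 * (f' X - f' τ) + f' τ * (t / b ^ 2 - t / a ^ 2))
      (f' τ * (X * (a - b) / a ^ 2))
    have r3 := abs_sub (t / b ^ 2 * (f' X - f' τ) + f' τ * (t / b ^ 2 - t / a ^ 2)
      - f' τ * (X * (a - b) / a ^ 2)) (f X * (1 / b - 1 / a))
    have t2 : |t| * |t| = t ^ 2 := by rw [← sq, sq_abs]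
    have t3 : 0 ≤ t ^ 2 * A ^ 2 := by positivity
    have t4 : 4 * |t| * (48 * |t| * (1 + A ^ 2) + |h X - h τ|)
        = 192 * t ^ 2 * (1 + A ^ 2) + 4 * |t| * |h X - h τ| := by rw [← t2]; ring
    linarith
  calc |t| * |t * f' X / b ^ 2 - (f X / b - f Y / a)|
      ≤ |t| * (240 * t ^ 2 * (1 + A ^ 2) + 4 * |t| * |h X - h τ|) := by gcongr
    _ = _ := by rw [← sq_abs t]; ring

/-- the ramp function -/
def ramp (x1 l : ℝ) (w : ℝ) : ℝ := max 0 (min 1 ((x1 + l - w) / l))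

lemma ramp_nonneg (x1 l w : ℝ) : 0 ≤ ramp x1 l w := le_max_left _ _
lemma ramp_le_one (x1 l w : ℝ) : ramp x1 l w ≤ 1 := max_le zero_le_one (min_le_left _ _)
lemma ramp_continuous (x1 l : ℝ) : Continuous (ramp x1 l) := by unfold ramp; fun_prop
lemma ramp_left {x1 l w : ℝ} (hl : 0 < l) (hw : w ≤ x1) : ramp x1 l w = 1 := by
  unfold ramp
  rw [min_eq_left, max_eq_right zero_le_one]
  rw [le_div_iff₀ hl]; linarith
lemma ramp_right {x1 l w : ℝ} (hl : 0 < l) (hw : x1 + l ≤ w) : ramp x1 l w = 0 := by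
  unfold ramp
  rw [max_eq_left]
  exact (min_le_right _ _).trans (div_nonpos_of_nonpos_of_nonneg (by linarith) hl.le)
lemma ramp_lip {x1 l : ℝ} (hl : 0 < l) (p q : ℝ) : |ramp x1 l p - ramp x1 l q| ≤ |p - q| / l := by
  unfold ramp
  have h1 := abs_max_sub_max_le_abs (min 1 ((x1 + l - p) / l)) (min 1 ((x1 + l - q) / l)) 0
  rw [max_comm _ 0, max_comm _ 0] at h1
  refine h1.trans ?_
  have h2 := abs_min_sub_min_le_max 1 ((x1 + l - p) / l) 1 ((x1 + l - q) / l)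
  refine h2.trans ?_
  rw [sub_self, abs_zero, max_eq_right (abs_nonneg _)]
  rw [← sub_div, abs_div, abs_of_pos hl, abs_sub_comm p q]
  apply le_of_eq; congr 2; ring
lemma ramp_diff_one (x1 l p q : ℝ) : |ramp x1 l p - ramp x1 l q| ≤ 1 := by
  have := ramp_nonneg x1 l p
  have := ramp_nonneg x1 l q
  have := ramp_le_one x1 l p
  have := ramp_le_one x1 l q
  rw [abs_le]; constructor <;> linarith

lemma T_close (a b t A : ℝ) (ha : 1 / 2 ≤ a) (hab : a ≤ b) (hbat : b ≤ a + |t|) :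
    |(t + A) / b - A / a| ≤ 2 * |t| * (1 + |A / a|) := by
  have hb : 1 / 2 ≤ b := ha.trans hab
  have ha0 : 0 < a := by linarith
  have hb0 : 0 < b := by linarith
  have e : (t + A) / b - A / a = (t + A / a * (a - b)) / b := by field_simp; ring
  rw [e, abs_div, abs_of_pos hb0, div_le_iff₀ hb0]
  have h1 : |t + A / a * (a - b)| ≤ |t| + |A / a| * |t| := by
    refine (abs_add_le _ _).trans ?_
    rw [abs_mul]
    refine add_le_add_right (mul_le_mul_of_nonneg_left ?_ (abs_nonneg _)) _
    rw [abs_le]; constructor <;> linarith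
  have : 0 ≤ |t| * (1 + |A / a|) := by positivity
  nlinarith

lemma ramp_diff (x ε x1 a b t A τ : ℝ) (hε : 0 < ε) (hε2 : ε ≤ 1 / 2)
    (hx1 : x - ε * (1 + |x|) ≤ x1) (hx1' : x1 ≤ x)
    (ha : 1 / 2 ≤ a) (hab : a ≤ b) (hbat : b ≤ a + |t|)
    (hτ : τ ∈ Set.uIcc (A / a) ((t + A) / b)) :
    |ramp x1 (ε * (1 + |x|)) ((t + A) / b) - ramp x1 (ε * (1 + |x|)) τ|
      ≤ 8 * |t| + min 1 (4 * |t| / ε) *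
        Set.indicator {y : ℝ | |y - x| ≤ (ε + 4 * |t|) * (1 + |x|)} 1 (A / a) := by
  have hcl := T_close a b t A ha hab hbat
  set X := (t + A) / b with hX
  set Y := A / a with hY
  set l := ε * (1 + |x|) with hl
  have hl0 : 0 < l := by positivity
  have hmin : 0 ≤ min 1 (4 * |t| / ε) := le_min zero_le_one (by positivity)
  have hind : (0:ℝ) ≤ Set.indicator {y : ℝ | |y - x| ≤ (ε + 4 * |t|) * (1 + |x|)} 1 Y :=
    Set.indicator_nonneg (fun _ _ => zero_le_one) _
  by_cases ht : 1 / 8 < |t|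
  · have := ramp_diff_one x1 l X τ
    have : 0 ≤ min 1 (4 * |t| / ε) *
      Set.indicator {y : ℝ | |y - x| ≤ (ε + 4 * |t|) * (1 + |x|)} 1 Y := mul_nonneg hmin hind
    linarith
  push Not at ht
  by_cases hne : ramp x1 l X = ramp x1 l τ
  · rw [hne, sub_self, abs_zero]
    exact add_nonneg (by positivity) (mul_nonneg hmin hind)
  -- a point close to x
  obtain ⟨p, hp, hpx⟩ : ∃ p, |Y - p| ≤ |X - Y| ∧ |p - x| ≤ l := by
    have hτ1 : |τ - Y| ≤ |X - Y| := Set.abs_sub_left_of_mem_uIcc hτ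
    have hτ2 : |X - τ| ≤ |X - Y| := Set.abs_sub_right_of_mem_uIcc hτ
    rw [abs_le] at hτ1 hτ2
    by_cases c1 : |X - x| ≤ l
    · exact ⟨X, by rw [abs_sub_comm], c1⟩
    by_cases c2 : |τ - x| ≤ l
    · exact ⟨τ, by rw [abs_sub_comm]; exact abs_le.2 hτ1, c2⟩
    refine ⟨x1, ?_, abs_le.2 ⟨by linarith, by linarith⟩⟩
    have hXc : X < x1 ∨ x1 + l < X := by
      by_contra! hc
      exact c1 (abs_le.2 ⟨by linarith [hc.1], by linarith [hc.2]⟩)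
    have hτc : τ < x1 ∨ x1 + l < τ := by
      by_contra! hc
      exact c2 (abs_le.2 ⟨by linarith [hc.1], by linarith [hc.2]⟩)
    have hm := Set.mem_uIcc.1 hτ
    rcases hXc with hXc | hXc <;> rcases hτc with hτc | hτc
    · exact absurd (by rw [ramp_left hl0 hXc.le, ramp_left hl0 hτc.le]) hne
    · rcases hm with hm | hm
      · linarith
      · rw [abs_of_nonneg (by linarith), abs_of_nonpos (by linarith)]; linarith
    · rcases hm with hm | hm
      · rw [abs_of_nonpos (by linarith), abs_of_nonneg (by linarith)]; linarith
      · linarith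
    · exact absurd (by rw [ramp_right hl0 hXc.le, ramp_right hl0 hτc.le]) hne
  have hYx : |Y - x| ≤ l + 2 * |t| * (1 + |Y|) := by
    have := abs_sub_le Y p x; linarith
  have hx0 := abs_nonneg x
  have hY0 := abs_nonneg Y
  have hYb : 1 + |Y| ≤ 2 * (1 + |x|) := by
    have h1 : |Y| ≤ |x| + |Y - x| := by
      have := abs_sub_abs_le_abs_sub Y x; linarith
    have h2 : 2 * |t| * (1 + |Y|) ≤ 1 / 4 * (1 + |Y|) := by gcongr; linarith
    have h3 : l ≤ 1 / 2 * (1 + |x|) := by rw [hl]; gcongr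
    linarith
  have h2t : 2 * |t| * (1 + |Y|) ≤ 4 * |t| * (1 + |x|) := by
    calc 2 * |t| * (1 + |Y|) ≤ 2 * |t| * (2 * (1 + |x|)) := by gcongr
      _ = _ := by ring
  have hmem : Y ∈ {y : ℝ | |y - x| ≤ (ε + 4 * |t|) * (1 + |x|)} := by
    show |Y - x| ≤ _
    rw [add_mul, ← hl]; linarith
  rw [Set.indicator_of_mem hmem, Pi.one_apply, mul_one]
  have : |ramp x1 l X - ramp x1 l τ| ≤ min 1 (4 * |t| / ε) := by
    apply le_min (ramp_diff_one _ _ _ _)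
    refine (ramp_lip hl0 _ _).trans ?_
    have hτ2 : |X - τ| ≤ |X - Y| := Set.abs_sub_right_of_mem_uIcc hτ
    rw [div_le_div_iff₀ hl0 hε]
    calc |X - τ| * ε ≤ (4 * |t| * (1 + |x|)) * ε := by gcongr; linarith
      _ = 4 * |t| * l := by rw [hl]; ring
  have := abs_nonneg t
  linarith


/-- sums and sums of squares -/
def sm {n : ℕ} (ω : Fin n → ℝ) : ℝ := ∑ i, ω i
def sq2 {n : ℕ} (ω : Fin n → ℝ) : ℝ := ∑ i, ω i ^ 2

@[fun_prop] lemma sm_measurable {n : ℕ} : Measurable (sm (n := n)) := by unfold sm; fun_prop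
@[fun_prop] lemma sq2_measurable {n : ℕ} : Measurable (sq2 (n := n)) := by unfold sq2; fun_prop
lemma sq2_nonneg {n : ℕ} (ω : Fin n → ℝ) : 0 ≤ sq2 ω := Finset.sum_nonneg fun _ _ => sq_nonneg _

lemma exch (ν : Measure ℝ) [IsProbabilityMeasure ν] (n : ℕ) (i : Fin (n + 1))
    (φ : ℝ → ℝ → ℝ → ℝ) :
    ∫ ω, φ (ω i) (sm ω) (sq2 ω) ∂(Measure.pi fun _ : Fin (n + 1) => ν)
      = ∫ p, φ p.1 (p.1 + sm p.2) (p.1 ^ 2 + sq2 p.2)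
          ∂(ν.prod (Measure.pi fun _ : Fin n => ν)) := by
  have hmp := measurePreserving_piFinSuccAbove (fun _ : Fin (n + 1) => ν) i
  rw [← hmp.integral_comp']
  congr 1; ext ω
  have e : MeasurableEquiv.piFinSuccAbove (fun _ : Fin (n+1) => ℝ) i ω
    = (ω i, fun j => ω (i.succAbove j)) := rfl
  rw [e]
  simp only [sm, sq2]
  rw [Fin.sum_univ_succAbove ω i, Fin.sum_univ_succAbove (fun j => ω j ^ 2) i]

lemma exch_integrable (ν : Measure ℝ) [IsProbabilityMeasure ν] (n : ℕ) (i : Fin (n + 1))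
    (φ : ℝ → ℝ → ℝ → ℝ) :
    Integrable (fun ω => φ (ω i) (sm ω) (sq2 ω)) (Measure.pi fun _ : Fin (n + 1) => ν) ↔
    Integrable (fun p : ℝ × (Fin n → ℝ) => φ p.1 (p.1 + sm p.2) (p.1 ^ 2 + sq2 p.2))
       (ν.prod (Measure.pi fun _ : Fin n => ν)) := by
  have hmp := measurePreserving_piFinSuccAbove (fun _ : Fin (n + 1) => ν) i
  rw [← hmp.integrable_comp_emb (MeasurableEquiv.measurableEmbedding _)]
  apply iff_of_eq; congr 1; ext ω
  have e : MeasurableEquiv.piFinSuccAbove (fun _ : Fin (n+1) => ℝ) i ω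
    = (ω i, fun j => ω (i.succAbove j)) := rfl
  simp only [Function.comp, e]
  simp only [sm, sq2]
  rw [Fin.sum_univ_succAbove ω i, Fin.sum_univ_succAbove (fun j => ω j ^ 2) i]

lemma exch_measure (ν : Measure ℝ) [IsProbabilityMeasure ν] (n : ℕ) (s : Set (ℝ × ℝ))
    (hs : MeasurableSet s) :
    (Measure.pi fun _ : Fin (n + 1) => ν).real {ω | (sm ω, sq2 ω) ∈ s}
      = (ν.prod (Measure.pi fun _ : Fin n => ν)).real
          {p | (p.1 + sm p.2, p.1 ^ 2 + sq2 p.2) ∈ s} := by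
  have h := exch ν n 0 (fun _ a b => s.indicator 1 (a, b))
  have m1 : MeasurableSet {ω : Fin (n+1) → ℝ | (sm ω, sq2 ω) ∈ s} := by
    have : Measurable fun ω : Fin (n+1) → ℝ => (sm ω, sq2 ω) := by fun_prop
    exact this hs
  have m2 : MeasurableSet {p : ℝ × (Fin n → ℝ) | (p.1 + sm p.2, p.1 ^ 2 + sq2 p.2) ∈ s} := by
    have : Measurable fun p : ℝ × (Fin n → ℝ) => (p.1 + sm p.2, p.1 ^ 2 + sq2 p.2) := by fun_prop
    exact this hs
  rw [← integral_indicator_one m1, ← integral_indicator_one m2]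
  exact h

/-- Leave-one-out identity. -/
lemma exch_sum (ν : Measure ℝ) [IsProbabilityMeasure ν] (n : ℕ) (k : ℝ → ℝ) (hk : Integrable k ν)
    (G : ℝ → ℝ → ℝ) (hG : Measurable (fun p : ℝ × ℝ => G p.1 p.2)) (M : ℝ)
    (hM : ∀ a b, |G a b| ≤ M)
    (c : ℝ → ℝ → ℝ) (hc : ∀ ω : Fin (n+1) → ℝ, c (sm ω) (sq2 ω) = ∑ i, k (ω i)) :
    ∫ p, c (p.1 + sm p.2) (p.1 ^ 2 + sq2 p.2) * G (p.1 + sm p.2) (p.1 ^ 2 + sq2 p.2)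
          ∂(ν.prod (Measure.pi fun _ : Fin n => ν))
      = (n + 1 : ℝ) * ∫ p, k p.1 * G (p.1 + sm p.2) (p.1 ^ 2 + sq2 p.2)
          ∂(ν.prod (Measure.pi fun _ : Fin n => ν)) := by
  rw [← exch ν n 0 (fun _ a b => c a b * G a b)]
  have e : ∀ ω : Fin (n+1) → ℝ, c (sm ω) (sq2 ω) * G (sm ω) (sq2 ω)
      = ∑ i, k (ω i) * G (sm ω) (sq2 ω) := by
    intro ω; rw [hc, Finset.sum_mul]
  simp_rw [e]
  rw [integral_finsetSum]
  · simp_rw [exch ν n _ (fun t a b => k t * G a b)]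
    simp
  · intro i _
    have hki : Integrable (fun ω : Fin (n+1) → ℝ => k (ω i)) (Measure.pi fun _ => ν) :=
      (measurePreserving_eval (fun _ : Fin (n+1) => ν) i).integrable_comp_of_integrable hk
    refine hki.mul_bdd (c := M) ?_ (ae_of_all _ fun ω => hM _ _)
    have : Measurable fun ω : Fin (n+1) → ℝ => G (sm ω) (sq2 ω) :=
      hG.comp (f := fun ω : Fin (n+1) → ℝ => (sm ω, sq2 ω)) (by fun_prop)
    exact this.aestronglyMeasurable

lemma sm_sq (ν : Measure ℝ) [IsProbabilityMeasure ν] (n : ℕ) (h1 : ∫ t, t ∂ν = 0)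
    (h2 : MemLp (fun t : ℝ => t) 2 ν) :
    Integrable (fun ω : Fin n → ℝ => sm ω ^ 2) (Measure.pi fun _ => ν) ∧
    ∫ ω : Fin n → ℝ, sm ω ^ 2 ∂(Measure.pi fun _ => ν) = n * ∫ t, t ^ 2 ∂ν := by
  have hev : ∀ i : Fin n, MemLp (fun ω : Fin n → ℝ => ω i) 2 (Measure.pi fun _ => ν) := fun i =>
    h2.comp_measurePreserving (measurePreserving_eval (fun _ : Fin n => ν) i)
  have hL : MemLp (fun ω : Fin n → ℝ => sm ω) 2 (Measure.pi fun _ => ν) := by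
    unfold sm
    exact memLp_finsetSum _ fun i _ => hev i
  refine ⟨hL.integrable_sq, ?_⟩
  have hv := variance_sum_pi (μ := fun _ : Fin n => ν) (X := fun _ t => t) (fun _ => h2)
  have e : (∑ i, fun ω : Fin n → ℝ => ω i) = fun ω => sm ω := by
    ext ω; simp [sm]
  simp only [e] at hv
  rw [variance_of_integral_eq_zero (by fun_prop), variance_of_integral_eq_zero (by fun_prop) h1] at hv
  · rw [hv]; simp
  · unfold sm
    rw [integral_finsetSum _ fun i _ => (hev i).integrable (by norm_num)]
    apply Finset.sum_eq_zero
    intro i _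
    rw [integral_comp_eval (μ := fun _ : Fin n => ν) (f := fun t : ℝ => t) (by fun_prop), h1]

lemma exp_neg_sq_le (s : ℝ) (hs : 0 ≤ s) : Real.exp (-s ^ 2) ≤ 1 - s ^ 2 + s ^ 3 := by
  rcases le_total 1 s with h | h
  · have : Real.exp (-s ^ 2) ≤ 1 := Real.exp_le_one_iff.2 (by nlinarith)
    nlinarith [mul_nonneg (sq_nonneg s) (sub_nonneg.2 h)]
  · have h1 := Real.add_one_le_exp (s ^ 2)
    have h2 : Real.exp (-s ^ 2) * Real.exp (s ^ 2) = 1 := by rw [← Real.exp_add]; simp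
    have h3 : Real.exp (-s ^ 2) * (1 + s ^ 2) ≤ 1 := by
      rw [← h2]; gcongr; linarith
    have h4 : 1 ≤ (1 - s ^ 2 + s ^ 4) * (1 + s ^ 2) := by nlinarith [pow_nonneg hs 6]
    have h5 : Real.exp (-s ^ 2) ≤ 1 - s ^ 2 + s ^ 4 :=
      le_of_mul_le_mul_right (h3.trans h4) (by positivity)
    have h6 : s ^ 4 ≤ s ^ 3 := by nlinarith [pow_nonneg hs 3]
    linarith

/-- Lower tail of the sum of squares. -/
lemma lower_tail (ν : Measure ℝ) [IsProbabilityMeasure ν] (m : ℕ) (hm : 0 < m)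
    (h2 : ∫ t, t ^ 2 ∂ν = 1 / m) (h3 : Integrable (fun t : ℝ => |t| ^ 3) ν)
    (h2i : Integrable (fun t : ℝ => t ^ 2) ν)
    (γ : ℝ) (hγ0 : 0 < γ) (hγ : m * ∫ t, |t| ^ 3 ∂ν ≤ γ) :
    (Measure.pi fun _ : Fin m => ν).real {ω | sq2 ω < 1 / 4} ≤ 16 * γ ^ 2 := by
  set s := 1 / (2 * γ) with hs
  have hs0 : 0 < s := by positivity
  have hm' : (0:ℝ) < m := by exact_mod_cast hm
  set E := ∫ t, Real.exp (-(s * t) ^ 2) ∂ν with hE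
  have hEi : Integrable (fun t : ℝ => Real.exp (-(s * t) ^ 2)) ν := by
    refine Integrable.of_bound (by fun_prop) 1 (ae_of_all _ fun t => ?_)
    rw [Real.norm_of_nonneg (Real.exp_pos _).le]
    exact Real.exp_le_one_iff.2 (by nlinarith [sq_nonneg (s * t)])
  have hE0 : 0 ≤ E := integral_nonneg fun t => (Real.exp_pos _).le
  have hE1 : E ≤ 1 - s ^ 2 / m + s ^ 3 * (γ / m) := by
    have : E ≤ ∫ t, (1 - s ^ 2 * t ^ 2 + s ^ 3 * |t| ^ 3) ∂ν := by
      apply integral_mono hEi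
      · exact ((integrable_const _).sub (h2i.const_mul _)).add (h3.const_mul _)
      · intro t
        have := exp_neg_sq_le (s * |t|) (by positivity)
        simp only [mul_pow, sq_abs] at this ⊢
        exact this
    have hi : Integrable (fun t : ℝ => 1 - s ^ 2 * t ^ 2) ν :=
      (integrable_const _).sub (h2i.const_mul _)
    rw [integral_add hi (h3.const_mul _),
      integral_sub (integrable_const _) (h2i.const_mul _), integral_const_mul, integral_const_mul,
      h2] at this
    simp only [integral_const, probReal_univ, smul_eq_mul, mul_one] at this
    have h4 : ∫ t, |t| ^ 3 ∂ν ≤ γ / m := by rw [le_div_iff₀ hm']; linarith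
    have h5 : s ^ 3 * ∫ t, |t| ^ 3 ∂ν ≤ s ^ 3 * (γ / m) := by gcongr
    rw [mul_one_div] at this
    linarith
  have hsγ : s * γ = 1 / 2 := by rw [hs]; field_simp
  have hE2 : E ≤ Real.exp (-(s ^ 2 / 2) / m) := by
    have := Real.add_one_le_exp (-(s ^ 2 / 2) / m)
    have e : 1 - s ^ 2 / m + s ^ 3 * (γ / m) = -(s ^ 2 / 2) / m + 1 := by
      have : s ^ 3 * (γ / m) = s ^ 2 * (s * γ) / m := by ring
      rw [this, hsγ]; ring
    linarith
  have hEm : E ^ m ≤ Real.exp (-(s ^ 2 / 2)) := by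
    calc E ^ m ≤ (Real.exp (-(s ^ 2 / 2) / m)) ^ m := by gcongr
      _ = Real.exp (-(s ^ 2 / 2)) := by
        rw [← Real.exp_nat_mul]; congr 1; field_simp
  have hprod := integral_fintype_prod_eq_pow (ι := Fin m) (μ := ν)
    (fun t : ℝ => Real.exp (-(s * t) ^ 2))
  have hpi : Integrable (fun ω : Fin m → ℝ => ∏ i, Real.exp (-(s * ω i) ^ 2))
      (Measure.pi fun _ => ν) :=
    Integrable.fintype_prod (f := fun _ t => Real.exp (-(s * t) ^ 2)) fun _ => hEi
  have hmk := mul_meas_ge_le_integral_of_nonneg (μ := Measure.pi fun _ : Fin m => ν)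
    (ae_of_all _ fun ω : Fin m → ℝ => Finset.prod_nonneg fun i _ => (Real.exp_pos (-(s * ω i) ^ 2)).le)
    hpi (Real.exp (-(s ^ 2 / 4)))
  rw [hprod, Fintype.card_fin, ← hE] at hmk
  have hsub : (Measure.pi fun _ : Fin m => ν).real {ω | sq2 ω < 1 / 4}
      ≤ (Measure.pi fun _ : Fin m => ν).real
        {ω | Real.exp (-(s ^ 2 / 4)) ≤ ∏ i, Real.exp (-(s * ω i) ^ 2)} := by
    apply measureReal_mono _ (measure_ne_top _ _)
    intro ω hω
    simp only [Set.mem_ofPred_eq] at hω ⊢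
    rw [← Real.exp_sum]
    apply Real.exp_le_exp.2
    have : ∑ i, -(s * ω i) ^ 2 = - (s ^ 2 * sq2 ω) := by
      unfold sq2; rw [Finset.mul_sum, ← Finset.sum_neg_distrib]
      congr 1; ext i; ring
    rw [this]; nlinarith [sq_pos_of_pos hs0]
  set p := (Measure.pi fun _ : Fin m => ν).real {ω | sq2 ω < 1 / 4} with hp
  have h6 : Real.exp (-(s ^ 2 / 4)) * p ≤ Real.exp (-(s ^ 2 / 2)) := by
    refine le_trans ?_ (hmk.trans hEm)
    gcongr
  have h7 : p ≤ Real.exp (-(s ^ 2 / 4)) := by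
    have : Real.exp (-(s ^ 2 / 2)) = Real.exp (-(s ^ 2 / 4)) * Real.exp (-(s ^ 2 / 4)) := by
      rw [← Real.exp_add]; congr 1; ring
    rw [this] at h6
    exact le_of_mul_le_mul_left h6 (Real.exp_pos _)
  refine h7.trans ?_
  have h8 := Real.add_one_le_exp (s ^ 2 / 4)
  have h9 : s ^ 2 / 4 = 1 / (16 * γ ^ 2) := by rw [hs]; field_simp; norm_num
  rw [Real.exp_neg]
  rw [inv_le_comm₀ (Real.exp_pos _) (by positivity)]
  rw [← one_div, ← h9]; linarith


set_option maxHeartbeats 1000000 in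
lemma stein_expect (ν : Measure ℝ) [IsProbabilityMeasure ν] (n : ℕ)
    (h1i : Integrable (fun t : ℝ => t) ν) (h1 : ∫ t, t ∂ν = 0)
    (h2i : Integrable (fun t : ℝ => t ^ 2) ν) (h2 : ∫ t, t ^ 2 ∂ν = 1 / (n + 1 : ℝ))
    (h3 : Integrable (fun t : ℝ => |t| ^ 3) ν)
    (x ε x1 L r D : ℝ) (hε : 0 < ε) (hε2 : ε ≤ 1 / 2)
    (hx1 : x - ε * (1 + |x|) ≤ x1) (hx1' : x1 ≤ x) (hL : 0 ≤ L) (hr : 0 ≤ r) (hD : 0 ≤ D)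
    (hconc : ∀ θ, 0 ≤ θ → (Measure.pi fun _ : Fin n => ν).real
      {ω | |sm ω / Ureg (sq2 ω) - x| ≤ θ * (1 + |x|)} ≤ L * (θ + r) + 3 * D) :
    |∫ p, ramp x1 (ε * (1 + |x|)) ((p.1 + sm p.2) / Ureg (p.1 ^ 2 + sq2 p.2))
          ∂(ν.prod (Measure.pi fun _ : Fin n => ν))
      - ∫ t, ramp x1 (ε * (1 + |x|)) t * (Real.exp (-t ^ 2 / 2) / Real.sqrt (2 * Real.pi))|
    ≤ 2 * (ν.prod (Measure.pi fun _ : Fin n => ν)).real {p | p.1 ^ 2 + sq2 p.2 < 1 / 4}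
      + ((n + 1 : ℝ) * ∫ t, |t| ^ 3 ∂ν) * (512 + 4 * (8 * L + 4 * L * r / ε + 12 * D / ε)) := by
  set μ := Measure.pi fun _ : Fin n => ν with hμ
  set ρ := ν.prod μ with hρ
  set h := ramp x1 (ε * (1 + |x|)) with hh
  have hhc : Continuous h := ramp_continuous _ _
  have hh0 : ∀ w, 0 ≤ h w := ramp_nonneg _ _
  have hh1 : ∀ w, h w ≤ 1 := ramp_le_one _ _
  obtain ⟨f, hf, hf3, hf1⟩ := stein_exists h hhc hh0 hh1
  set c := ∫ t, h t * (Real.exp (-t ^ 2 / 2) / Real.sqrt (2 * Real.pi)) with hc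
  have hc0 : 0 ≤ c := integral_nonneg fun t => mul_nonneg (hh0 t) (phi_nonneg t)
  have hc1 : c ≤ 1 := by
    rw [← phi_integral]
    apply integral_mono_of_nonneg (ae_of_all _ fun t => mul_nonneg (hh0 t) (phi_nonneg t))
      phi_integrable
    exact ae_of_all _ fun t => mul_le_of_le_one_left (phi_nonneg t) (hh1 t)
  have hf2 : ∀ w, |w * f w + h w - c| ≤ 2 := by
    intro w
    have a1 := abs_le.1 (hf1 w)
    have := hh0 w
    have := hh1 w
    rw [abs_le]; constructor <;> linarith [a1.1, a1.2]
  have hfm : Measurable f :=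
    (continuous_iff_continuousAt.2 fun w => (hf w).continuousAt).measurable
  have hhm : Measurable h := hhc.measurable
  set f' : ℝ → ℝ := fun w => w * f w + h w - c with hf'
  have hf'm : Measurable f' := by fun_prop
  set X : ℝ × (Fin n → ℝ) → ℝ := fun p => (p.1 + sm p.2) / Ureg (p.1 ^ 2 + sq2 p.2) with hX
  set Y : (Fin n → ℝ) → ℝ := fun ω => sm ω / Ureg (sq2 ω) with hY
  set U : ℝ × (Fin n → ℝ) → ℝ := fun p => Ureg (p.1 ^ 2 + sq2 p.2) with hU
  set U0 : (Fin n → ℝ) → ℝ := fun ω => Ureg (sq2 ω) with hU0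
  have hXm : Measurable X := by fun_prop
  have hYm : Measurable Y := by fun_prop
  have hUm : Measurable U := by fun_prop
  have hU0m : Measurable U0 := by fun_prop
  have hUinv : ∀ q, |1 / Ureg q| ≤ 2 := by
    intro q
    have := Ureg_half q
    rw [abs_of_pos (by positivity), div_le_iff₀ (by linarith)]; linarith
  have hn1 : (0:ℝ) < n + 1 := by positivity
  -- basic integrability on the product
  have it1 : Integrable (fun p : ℝ × (Fin n → ℝ) => p.1) ρ := h1i.comp_fst μ
  have it2 : Integrable (fun p : ℝ × (Fin n → ℝ) => p.1 ^ 2) ρ := h2i.comp_fst μ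
  have it3 : Integrable (fun p : ℝ × (Fin n → ℝ) => |p.1| ^ 3) ρ := h3.comp_fst μ
  have bdd : ∀ g : ℝ × (Fin n → ℝ) → ℝ, Measurable g → ∀ M, (∀ p, |g p| ≤ M) → Integrable g ρ :=
    fun g hg M hM => Integrable.of_bound hg.aestronglyMeasurable M (ae_of_all _ hM)
  -- identity 1
  have I1 : ∫ p, X p * f (X p) ∂ρ = (n + 1 : ℝ) * ∫ p, p.1 * (f (X p) / U p) ∂ρ := by
    have := exch_sum ν n (fun t => t) h1i (fun a b => f (a / Ureg b) / Ureg b) (by fun_prop) 6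
      (fun a b => by
        rw [div_eq_mul_one_div, abs_mul]
        have := hf3 (a / Ureg b)
        have := hUinv b
        nlinarith [abs_nonneg (f (a / Ureg b)), abs_nonneg (1 / Ureg b)])
      (fun a _ => a) (fun ω => rfl)
    rw [← this]
    congr 1; ext p; simp only [hX]; ring
  have ifU : Integrable (fun p : ℝ × (Fin n → ℝ) => p.1 * (f (X p) / U p)) ρ := by
    refine it1.mul_bdd (c := 6) (Measurable.aestronglyMeasurable (by fun_prop)) (ae_of_all _ fun p => ?_)
    rw [Real.norm_eq_abs, div_eq_mul_one_div, abs_mul]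
    have := hf3 (X p)
    have := hUinv (p.1 ^ 2 + sq2 p.2)
    nlinarith [abs_nonneg (f (X p)), abs_nonneg (1 / Ureg (p.1 ^ 2 + sq2 p.2))]
  have ifU0 : Integrable (fun p : ℝ × (Fin n → ℝ) => p.1 * (f (Y p.2) / U0 p.2)) ρ := by
    refine it1.mul_bdd (c := 6) (Measurable.aestronglyMeasurable (by fun_prop)) (ae_of_all _ fun p => ?_)
    rw [Real.norm_eq_abs, div_eq_mul_one_div, abs_mul]
    have := hf3 (Y p.2)
    have := hUinv (sq2 p.2)
    nlinarith [abs_nonneg (f (Y p.2)), abs_nonneg (1 / Ureg (sq2 p.2))]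
  have I1' : ∫ p, p.1 * (f (Y p.2) / U0 p.2) ∂ρ = 0 := by
    have := integral_prod_mul (μ := ν) (ν := μ) (fun t : ℝ => t) (fun ω => f (Y ω) / U0 ω)
    rw [hρ, this, h1, zero_mul]
  -- identity 2
  have I2 : ∫ p, (p.1 ^ 2 + sq2 p.2) * (f' (X p) / U p ^ 2) ∂ρ
      = (n + 1 : ℝ) * ∫ p, p.1 ^ 2 * (f' (X p) / U p ^ 2) ∂ρ := by
    have := exch_sum ν n (fun t => t ^ 2) h2i (fun a b => f' (a / Ureg b) / Ureg b ^ 2)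
      (by fun_prop) 8
      (fun a b => by
        have e : f' (a / Ureg b) / Ureg b ^ 2 = f' (a / Ureg b) * (1 / Ureg b) ^ 2 := by
          rw [one_div, inv_pow]; rfl
        rw [e, abs_mul, abs_pow]
        calc |f' (a / Ureg b)| * |1 / Ureg b| ^ 2 ≤ 2 * 2 ^ 2 := by
              gcongr
              · exact hf2 _
              · exact hUinv b
          _ = 8 := by norm_num)
      (fun _ b => b) (fun ω => rfl)
    rw [← this]
  have if'U : Integrable (fun p : ℝ × (Fin n → ℝ) => p.1 ^ 2 * (f' (X p) / U p ^ 2)) ρ := by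
    refine it2.mul_bdd (c := 8) (Measurable.aestronglyMeasurable (by fun_prop)) (ae_of_all _ fun p => ?_)
    have e : f' (X p) / U p ^ 2 = f' (X p) * (1 / U p) ^ 2 := by
      rw [one_div, inv_pow]; rfl
    rw [Real.norm_eq_abs, e, abs_mul, abs_pow]
    calc |f' (X p)| * |1 / U p| ^ 2 ≤ 2 * 2 ^ 2 := by
          gcongr
          · exact hf2 _
          · exact hUinv _
      _ = 8 := by norm_num
  have hq0 : ∀ p : ℝ × (Fin n → ℝ), 0 ≤ p.1 ^ 2 + sq2 p.2 := fun p =>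
    add_nonneg (sq_nonneg _) (sq2_nonneg _)
  have hqU : ∀ p : ℝ × (Fin n → ℝ), (p.1 ^ 2 + sq2 p.2) / U p ^ 2 ≤ 1 := by
    intro p
    simp only [hU]
    rw [Ureg_sq, div_le_one (by positivity)]; exact le_max_left _ _
  have hqU0 : ∀ p : ℝ × (Fin n → ℝ), 0 ≤ (p.1 ^ 2 + sq2 p.2) / U p ^ 2 := fun p =>
    div_nonneg (hq0 p) (sq_nonneg _)
  have iq : Integrable (fun p : ℝ × (Fin n → ℝ) =>
      (p.1 ^ 2 + sq2 p.2) * (f' (X p) / U p ^ 2)) ρ := by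
    apply bdd _ (by fun_prop) 2
    intro p
    have e : (p.1 ^ 2 + sq2 p.2) * (f' (X p) / U p ^ 2)
      = (p.1 ^ 2 + sq2 p.2) / U p ^ 2 * f' (X p) := by ring
    rw [e, abs_mul, abs_of_nonneg (hqU0 p)]
    exact le_trans (mul_le_of_le_one_left (abs_nonneg _) (hqU p)) (hf2 _)
  have if' : Integrable (fun p => f' (X p)) ρ := bdd _ (by fun_prop) 2 fun p => hf2 _
  have iXf : Integrable (fun p => X p * f (X p)) ρ := bdd _ (by fun_prop) 1 fun p => hf1 _
  -- remainder term
  set Z : ℝ × (Fin n → ℝ) → ℝ := fun p =>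
    p.1 ^ 2 * f' (X p) / U p ^ 2 - p.1 * (f (X p) / U p - f (Y p.2) / U0 p.2) with hZ
  have hZi : ∫ p, Z p ∂ρ = ∫ p, p.1 ^ 2 * (f' (X p) / U p ^ 2) ∂ρ
      - ∫ p, p.1 * (f (X p) / U p) ∂ρ := by
    have e : Z = fun p => p.1 ^ 2 * (f' (X p) / U p ^ 2)
      - (p.1 * (f (X p) / U p) - p.1 * (f (Y p.2) / U0 p.2)) := by
      ext p; simp only [hZ]; ring
    have hs : Integrable (fun p : ℝ × (Fin n → ℝ) =>
      p.1 * (f (X p) / U p) - p.1 * (f (Y p.2) / U0 p.2)) ρ := ifU.sub ifU0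
    simp only [e]
    rw [integral_sub if'U hs, integral_sub ifU ifU0, I1', sub_zero]
  have hmain : ∫ p, h (X p) ∂ρ - c
      = ∫ p, (f' (X p) - (p.1 ^ 2 + sq2 p.2) * (f' (X p) / U p ^ 2)) ∂ρ
        + (n + 1 : ℝ) * ∫ p, Z p ∂ρ := by
    rw [hZi, mul_sub, ← I1, ← I2, integral_sub if' iq]
    have e : ∫ p, h (X p) ∂ρ = ∫ p, (f' (X p) - X p * f (X p) + c) ∂ρ := by
      congr 1; ext p; simp only [hf']; ring
    have hs : Integrable (fun p => f' (X p) - X p * f (X p)) ρ := if'.sub iXf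
    rw [e, integral_add hs (integrable_const _), integral_sub if' iXf]
    simp only [integral_const, probReal_univ, smul_eq_mul, one_mul]
    ring
  -- first remainder
  have hms : MeasurableSet {p : ℝ × (Fin n → ℝ) | p.1 ^ 2 + sq2 p.2 < 1 / 4} :=
    measurableSet_lt (by fun_prop) (by fun_prop)
  have R1 : |∫ p, (f' (X p) - (p.1 ^ 2 + sq2 p.2) * (f' (X p) / U p ^ 2)) ∂ρ|
      ≤ 2 * ρ.real {p | p.1 ^ 2 + sq2 p.2 < 1 / 4} := by
    have hi : Integrable (fun p => 2 * Set.indicator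
        {p : ℝ × (Fin n → ℝ) | p.1 ^ 2 + sq2 p.2 < 1 / 4} (1 : ℝ × (Fin n → ℝ) → ℝ) p) ρ :=
      ((integrable_const (1:ℝ)).indicator hms).const_mul 2
    rw [← integral_indicator_one hms, ← integral_const_mul]
    rw [← Real.norm_eq_abs]
    refine norm_integral_le_of_norm_le hi (ae_of_all _ fun p => ?_)
    rw [Real.norm_eq_abs]
    by_cases hp : p.1 ^ 2 + sq2 p.2 < 1 / 4
    · rw [Set.indicator_of_mem (by exact hp), Pi.one_apply, mul_one]
      have e : f' (X p) - (p.1 ^ 2 + sq2 p.2) * (f' (X p) / U p ^ 2)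
        = (1 - (p.1 ^ 2 + sq2 p.2) / U p ^ 2) * f' (X p) := by ring
      rw [e, abs_mul, abs_of_nonneg (by linarith [hqU p])]
      exact le_trans (mul_le_of_le_one_left (abs_nonneg _) (by linarith [hqU0 p])) (hf2 _)
    · rw [Set.indicator_of_notMem (by exact hp), mul_zero]
      push Not at hp
      have e : U p ^ 2 = p.1 ^ 2 + sq2 p.2 := by
        simp only [hU]; rw [Ureg_sq, max_eq_left hp]
      rw [e, mul_div_cancel₀ _ (by linarith), sub_self, abs_zero]
  -- second remainder
  set W : ℝ × (Fin n → ℝ) → ℝ := fun p => (p.1 ^ 2 * min 1 (4 * |p.1| / ε)) *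
    Set.indicator {y : ℝ | |y - x| ≤ (ε + 4 * |p.1|) * (1 + |x|)} 1 (Y p.2) with hW
  have hWset : MeasurableSet {p : ℝ × (Fin n → ℝ) |
      |Y p.2 - x| ≤ (ε + 4 * |p.1|) * (1 + |x|)} :=
    measurableSet_le (by fun_prop) (by fun_prop)
  have hWe : W = fun p => (p.1 ^ 2 * min 1 (4 * |p.1| / ε)) *
      Set.indicator {p : ℝ × (Fin n → ℝ) | |Y p.2 - x| ≤ (ε + 4 * |p.1|) * (1 + |x|)} 1 p := by
    ext p; rfl
  have hmin0 : ∀ t : ℝ, 0 ≤ min 1 (4 * |t| / ε) := fun t => le_min zero_le_one (by positivity)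
  have hWm : Measurable W := by
    rw [hWe]
    exact Measurable.mul (by fun_prop) (measurable_one.indicator hWset)
  have hWi : Integrable W ρ := by
    refine it2.mono hWm.aestronglyMeasurable (ae_of_all _ fun p => ?_)
    simp only [hW, norm_mul]
    rw [mul_assoc]
    apply mul_le_of_le_one_right (norm_nonneg _)
    apply mul_le_one₀ _ (norm_nonneg _)
    · refine (norm_indicator_le_norm_self _ _).trans ?_
      simp
    · rw [Real.norm_of_nonneg (hmin0 _)]; exact min_le_left _ _
  have hZb : ∀ p, ‖Z p‖ ≤ 240 * (|p.1| ^ 3 * (1 + sm p.2 ^ 2)) + 32 * |p.1| ^ 3 + 4 * W p := by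
    intro p
    obtain ⟨F1, F2, F3, F4⟩ := Ureg_facts (sq2 p.2) p.1 (sq2_nonneg _)
    obtain ⟨τ, hτ, hb⟩ := pointwise_stein f h c (U0 p.2) (U p) p.1 (sm p.2) hf hf3 hf2
      (Ureg_half _) F1 F2 F3 F4
    have hrd := ramp_diff x ε x1 (U0 p.2) (U p) p.1 (sm p.2) τ hε hε2 hx1 hx1'
      (Ureg_half _) F1 F3 hτ
    rw [Real.norm_eq_abs]
    refine hb.trans ?_
    have hm : 4 * p.1 ^ 2 * |h ((p.1 + sm p.2) / U p) - h τ|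
        ≤ 4 * p.1 ^ 2 * (8 * |p.1| + min 1 (4 * |p.1| / ε) *
        Set.indicator {y : ℝ | |y - x| ≤ (ε + 4 * |p.1|) * (1 + |x|)} 1 (Y p.2)) := by
      gcongr
    refine (add_le_add_right hm _).trans (le_of_eq ?_)
    simp only [hW]
    rw [← sq_abs p.1]; ring
  have hL2 : MemLp (fun t : ℝ => t) 2 ν :=
    (memLp_two_iff_integrable_sq (by fun_prop)).2 h2i
  obtain ⟨iA, eA⟩ := sm_sq ν n h1 hL2
  have iA1 : Integrable (fun ω : Fin n → ℝ => 1 + sm ω ^ 2) μ := (integrable_const _).add iA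
  have i3A : Integrable (fun p : ℝ × (Fin n → ℝ) => |p.1| ^ 3 * (1 + sm p.2 ^ 2)) ρ :=
    h3.mul_prod iA1
  have hA1 : ∫ ω, (1 + sm ω ^ 2) ∂μ ≤ 2 := by
    rw [integral_add (integrable_const _) iA, eA, h2]
    have : (n : ℝ) * (1 / (n + 1)) ≤ 1 := by rw [mul_one_div, div_le_one hn1]; linarith
    simp only [integral_const, probReal_univ, smul_eq_mul, one_mul]
    linarith
  set g3 := ∫ t, |t| ^ 3 ∂ν with hg3
  have hg30 : 0 ≤ g3 := integral_nonneg fun t => by positivity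
  have E1 : ∫ p, |p.1| ^ 3 * (1 + sm p.2 ^ 2) ∂ρ ≤ 2 * g3 := by
    have := integral_prod_mul (μ := ν) (ν := μ) (fun t : ℝ => |t| ^ 3) (fun ω => 1 + sm ω ^ 2)
    rw [hρ, this]; nlinarith
  have E2 : ∫ p, |p.1| ^ 3 ∂ρ = g3 := by
    have := integral_prod_mul (μ := ν) (ν := μ) (fun t : ℝ => |t| ^ 3) (fun _ => 1)
    simpa using this
  have E3 : ∫ p, W p ∂ρ ≤ (8 * L + 4 * L * r / ε + 12 * D / ε) * g3 := by
    rw [hρ, integral_prod W hWi, hg3, ← integral_const_mul]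
    have hin : ∀ t, ∫ ω, W (t, ω) ∂μ ≤ (8 * L + 4 * L * r / ε + 12 * D / ε) * |t| ^ 3 := by
      intro t
      have ms : MeasurableSet {ω : Fin n → ℝ | |Y ω - x| ≤ (ε + 4 * |t|) * (1 + |x|)} :=
        measurableSet_le (by fun_prop) (by fun_prop)
      have e : ∫ ω, W (t, ω) ∂μ = (t ^ 2 * min 1 (4 * |t| / ε)) *
          μ.real {ω : Fin n → ℝ | |Y ω - x| ≤ (ε + 4 * |t|) * (1 + |x|)} := by
        simp only [hW]
        rw [integral_const_mul, ← integral_indicator_one ms]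
        rfl
      rw [e]
      have hc := hconc (ε + 4 * |t|) (by positivity)
      have m1 : min 1 (4 * |t| / ε) ≤ 4 * |t| / ε := min_le_right _ _
      have m2 : min 1 (4 * |t| / ε) ≤ 1 := min_le_left _ _
      have k1 : min 1 (4 * |t| / ε) * (L * (ε + 4 * |t| + r) + 3 * D)
          ≤ (8 * L + 4 * L * r / ε + 12 * D / ε) * |t| := by
        have q1 : min 1 (4 * |t| / ε) * (L * ε + L * r + 3 * D)
            ≤ 4 * |t| / ε * (L * ε + L * r + 3 * D) := by gcongr
        have q2 : min 1 (4 * |t| / ε) * (L * (4 * |t|)) ≤ 1 * (L * (4 * |t|)) := by gcongr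
        have q3 : 4 * |t| / ε * (L * ε + L * r + 3 * D)
          = 4 * L * |t| + (4 * L * r / ε + 12 * D / ε) * |t| := by field_simp; ring
        linarith
      calc t ^ 2 * min 1 (4 * |t| / ε) * μ.real {ω | |Y ω - x| ≤ (ε + 4 * |t|) * (1 + |x|)}
          ≤ t ^ 2 * min 1 (4 * |t| / ε) * (L * (ε + 4 * |t| + r) + 3 * D) := by
            apply mul_le_mul_of_nonneg_left hc
            exact mul_nonneg (sq_nonneg _) (hmin0 t)
        _ = t ^ 2 * (min 1 (4 * |t| / ε) * (L * (ε + 4 * |t| + r) + 3 * D)) := by ring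
        _ ≤ t ^ 2 * ((8 * L + 4 * L * r / ε + 12 * D / ε) * |t|) := by gcongr
        _ = _ := by rw [← sq_abs t]; ring
    exact integral_mono hWi.integral_prod_left (h3.const_mul _) hin
  have R2 : |∫ p, Z p ∂ρ| ≤ (512 + 4 * (8 * L + 4 * L * r / ε + 12 * D / ε)) * g3 := by
    have hi : Integrable (fun p : ℝ × (Fin n → ℝ) => 240 * (|p.1| ^ 3 * (1 + sm p.2 ^ 2)) + 32 * |p.1| ^ 3) ρ :=
      (i3A.const_mul 240).add (it3.const_mul 32)
    have hi2 : Integrable (fun p : ℝ × (Fin n → ℝ) =>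
        240 * (|p.1| ^ 3 * (1 + sm p.2 ^ 2)) + 32 * |p.1| ^ 3 + 4 * W p) ρ :=
      hi.add (hWi.const_mul 4)
    have hb := norm_integral_le_of_norm_le hi2 (ae_of_all _ hZb)
    have e : ∫ p, (240 * (|p.1| ^ 3 * (1 + sm p.2 ^ 2)) + 32 * |p.1| ^ 3 + 4 * W p) ∂ρ
        = 240 * ∫ p, |p.1| ^ 3 * (1 + sm p.2 ^ 2) ∂ρ + 32 * ∫ p, |p.1| ^ 3 ∂ρ
          + 4 * ∫ p, W p ∂ρ := by
      rw [integral_add hi (hWi.const_mul 4), integral_add (i3A.const_mul 240) (it3.const_mul 32),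
        integral_const_mul, integral_const_mul, integral_const_mul]
    rw [e, E2, Real.norm_eq_abs] at hb
    linarith
  rw [hmain]
  refine (abs_add_le _ _).trans ?_
  refine add_le_add R1 ?_
  rw [abs_mul, abs_of_pos hn1, mul_assoc, mul_comm g3]
  gcongr


/-- the regularized statistic on the product space -/
def Xr (n : ℕ) (p : ℝ × (Fin n → ℝ)) : ℝ := (p.1 + sm p.2) / Ureg (p.1 ^ 2 + sq2 p.2)

@[fun_prop]
lemma Xr_measurable (n : ℕ) : Measurable (Xr n) := by
  unfold Xr; fun_prop

lemma conc_bound (ν : Measure ℝ) [IsProbabilityMeasure ν] (n : ℕ)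
    (h2i : Integrable (fun t : ℝ => t ^ 2) ν) (h2 : ∫ t, t ^ 2 ∂ν = 1 / (n + 1 : ℝ))
    (D : ℝ) (hD0 : 0 ≤ D)
    (hD : ∀ x, |(ν.prod (Measure.pi fun _ : Fin n => ν)).real {p | Xr n p ≤ x} - Φ x| ≤ D)
    (x θ : ℝ) (hθ : 0 ≤ θ) :
    (Measure.pi fun _ : Fin n => ν).real
      {ω | |sm ω / Ureg (sq2 ω) - x| ≤ θ * (1 + |x|)}
      ≤ 55 * (θ + 2 / Real.sqrt (n + 1)) + 3 * D := by
  set μ := Measure.pi fun _ : Fin n => ν with hμ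
  set r := 2 / Real.sqrt (n + 1 : ℝ) with hr
  have hs1 : 1 ≤ Real.sqrt (n + 1 : ℝ) := by
    rw [Real.one_le_sqrt]; linarith [Nat.cast_nonneg (α := ℝ) n]
  have hr0 : 0 < r := by positivity
  have hr2 : r ≤ 2 := by rw [hr, div_le_iff₀ (by linarith)]; linarith
  have hrsq : r ^ 2 = 4 / (n + 1 : ℝ) := by
    rw [hr, div_pow, Real.sq_sqrt (by positivity)]; norm_num
  set A := {ω : Fin n → ℝ | |sm ω / Ureg (sq2 ω) - x| ≤ θ * (1 + |x|)} with hA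
  have hcheb : 3 / 4 ≤ ν.real {t : ℝ | |t| ≤ r} := by
    have hm := mul_meas_ge_le_integral_of_nonneg (μ := ν) (f := fun t : ℝ => t ^ 2)
      (ae_of_all _ fun t => sq_nonneg t) h2i (r ^ 2)
    rw [h2] at hm
    have hc : ν.real {t : ℝ | |t| ≤ r}ᶜ ≤ ν.real {t : ℝ | r ^ 2 ≤ t ^ 2} := by
      refine measureReal_mono ?_ (measure_ne_top _ _)
      · intro t ht
        simp only [Set.mem_compl_iff, Set.mem_ofPred_eq, not_le] at ht ⊢
        rw [← sq_abs t]; gcongr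
    rw [probReal_compl_eq_one_sub (measurableSet_le (by fun_prop) (by fun_prop))] at hc
    have hn : (0:ℝ) < n + 1 := by positivity
    have hm' : r ^ 2 * ν.real {t : ℝ | r ^ 2 ≤ t ^ 2} ≤ r ^ 2 * (1 / 4) := by
      have e : r ^ 2 * (1 / 4) = 1 / (n + 1 : ℝ) := by rw [hrsq]; ring
      rw [e]; exact hm
    have := le_of_mul_le_mul_left hm' (by positivity)
    linarith
  set κ := 5 * θ + 2 * r with hκ
  have hκ0 : 0 < κ := by positivity
  set a1 := 1 + |x| with ha1
  have ha1p : 0 < a1 := by positivity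
  have hsub : {t : ℝ | |t| ≤ r} ×ˢ A ⊆ {p | |Xr n p - x| ≤ κ * a1} := by
    rintro ⟨t, ω⟩ ⟨ht, hω⟩
    simp only [Set.mem_ofPred_eq, hA] at ht hω ⊢
    obtain ⟨F1, F2, F3, F4⟩ := Ureg_facts (sq2 ω) t (sq2_nonneg _)
    have hc := T_close (Ureg (sq2 ω)) (Ureg (t ^ 2 + sq2 ω)) t (sm ω) (Ureg_half _) F1 F3
    set y := sm ω / Ureg (sq2 ω)
    have h1 : |y| ≤ |x| + θ * a1 := by
      have := abs_sub_abs_le_abs_sub y x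
      linarith
    have h2 : |Xr n (t, ω) - x| ≤ |Xr n (t, ω) - y| + |y - x| := abs_sub_le _ _ _
    have h3 : |Xr n (t, ω) - y| ≤ 2 * r * (a1 + θ * a1) := by
      refine hc.trans ?_
      have hy : 1 + |y| ≤ a1 + θ * a1 := by linarith
      exact mul_le_mul (by linarith) hy (by positivity) (by positivity)
    have h4 : r * (θ * a1) ≤ 2 * (θ * a1) := by gcongr
    have e : κ * a1 = 5 * (θ * a1) + 2 * (r * a1) := by rw [hκ]; ring
    rw [e]
    linarith
  have hprod : ν.real {t : ℝ | |t| ≤ r} * μ.real A ≤ (ν.prod μ).real {p | |Xr n p - x| ≤ κ * a1} := by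
    rw [← measureReal_prod_prod]
    exact measureReal_mono hsub
  have hA0 : 0 ≤ μ.real A := measureReal_nonneg
  have h34 : 3 / 4 * μ.real A ≤ (ν.prod μ).real {p | |Xr n p - x| ≤ κ * a1} :=
    (mul_le_mul_of_nonneg_right hcheb hA0).trans hprod
  by_cases hk : 2 * κ ≤ 1 / 2
  · have hb := hD (x + κ * a1)
    have ha := hD (x - 2 * κ * a1)
    have hdiff : (ν.prod μ).real {p | |Xr n p - x| ≤ κ * a1} ≤
        (ν.prod μ).real {p | Xr n p ≤ x + κ * a1}
        - (ν.prod μ).real {p | Xr n p ≤ x - 2 * κ * a1} := by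
      have hka : 0 < κ * a1 := by positivity
      rw [← measureReal_diff]
      · refine measureReal_mono ?_ (measure_ne_top _ _)
        intro p hp
        simp only [Set.mem_ofPred_eq, Set.mem_diff, not_le] at hp ⊢
        rw [abs_le] at hp
        constructor <;> linarith [hp.1, hp.2]
      · intro p hp
        simp only [Set.mem_ofPred_eq] at hp ⊢
        linarith
      · exact measurableSet_le (by fun_prop) (by fun_prop)
    have hΦb := Phi_close x (x + κ * a1) κ (by linarith) (by
      rw [add_sub_cancel_left, abs_of_pos (by positivity)])
    have hΦa := Phi_close x (x - 2 * κ * a1) (2 * κ) hk (by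
      rw [sub_sub_cancel_left, abs_neg, abs_of_pos (by positivity)])
    rw [abs_le] at hb ha hΦb hΦa
    have : 3 / 4 * μ.real A ≤ 6 * κ + 2 * D := by linarith [hb.1, hb.2, ha.1, ha.2, hΦb.1, hΦb.2, hΦa.1, hΦa.2]
    rw [hκ] at this
    linarith
  · push Not at hk
    have : μ.real A ≤ 1 := measureReal_le_one
    rw [hκ] at hk
    linarith

lemma self_bound (ν : Measure ℝ) [IsProbabilityMeasure ν] (n : ℕ)
    (h1i : Integrable (fun t : ℝ => t) ν) (h1 : ∫ t, t ∂ν = 0)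
    (h2i : Integrable (fun t : ℝ => t ^ 2) ν) (h2 : ∫ t, t ^ 2 ∂ν = 1 / (n + 1 : ℝ))
    (h3 : Integrable (fun t : ℝ => |t| ^ 3) ν)
    (γ : ℝ) (hγ : 0 < γ) (hγ3 : (n + 1 : ℝ) * ∫ t, |t| ^ 3 ∂ν ≤ γ)
    (hγ1 : 1 / Real.sqrt (n + 1) ≤ γ) (hγs : γ ≤ 1 / 192)
    (D : ℝ) (hD0 : 0 ≤ D)
    (hD : ∀ x, |(ν.prod (Measure.pi fun _ : Fin n => ν)).real {p | Xr n p ≤ x} - Φ x| ≤ D)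
    (x : ℝ) :
    |(ν.prod (Measure.pi fun _ : Fin n => ν)).real {p | Xr n p ≤ x} - Φ x| ≤
      2500 * γ + D / 2 := by
  have hconc := conc_bound ν n h2i h2 D hD0 hD x
  set μ := Measure.pi fun _ : Fin n => ν with hμ
  set ρ := ν.prod μ with hρ
  set ε := 96 * γ with hε
  have hε0 : 0 < ε := by positivity
  have hε2 : ε ≤ 1 / 2 := by linarith
  set r := 2 / Real.sqrt (n + 1 : ℝ) with hr
  have hr0 : 0 ≤ r := by positivity
  have hr2 : r ≤ 2 * γ := by
    have : r = 2 * (1 / Real.sqrt (n + 1 : ℝ)) := by rw [hr]; ring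
    linarith
  set l := ε * (1 + |x|) with hl
  have hl0 : 0 < l := by positivity
  have hlow : ρ.real {p | p.1 ^ 2 + sq2 p.2 < 1 / 4} ≤ 16 * γ ^ 2 := by
    have := lower_tail ν (n + 1) (by omega) (by push_cast; exact h2) h3 h2i γ hγ (by
      push_cast; exact hγ3)
    have e := exch_measure ν n {q : ℝ × ℝ | q.2 < 1 / 4}
      (measurableSet_lt (by fun_prop) (by fun_prop))
    simp only [Set.mem_ofPred_eq] at e
    rw [e] at this
    exact this
  have hg0 : 0 ≤ ∫ t, |t| ^ 3 ∂ν := integral_nonneg fun t => by positivity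
  -- error from Stein
  have herr : ∀ x1, x - ε * (1 + |x|) ≤ x1 → x1 ≤ x →
      |∫ p, ramp x1 l (Xr n p) ∂ρ
      - ∫ t, ramp x1 l t * (Real.exp (-t ^ 2 / 2) / Real.sqrt (2 * Real.pi))|
      ≤ 2293 * γ + D / 2 := by
    intro x1 hx1 hx1'
    have hs := stein_expect ν n h1i h1 h2i h2 h3 x ε x1 55 r D hε0 hε2 hx1 hx1' (by norm_num)
      hr0 hD0 (fun θ hθ => hconc θ hθ)
    refine hs.trans ?_
    have q1 : 4 * 55 * r / ε ≤ 5 := by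
      rw [div_le_iff₀ hε0]; linarith
    have hDε : 0 ≤ 12 * D / ε := by positivity
    have q2 : γ * (12 * D / ε) = D / 8 := by rw [hε, mul_div_assoc', div_eq_iff (by positivity)]; ring
    have q3 : ((n + 1 : ℝ) * ∫ t, |t| ^ 3 ∂ν) * (512 + 4 * (8 * 55 + 4 * 55 * r / ε + 12 * D / ε))
      ≤ γ * (512 + 4 * (8 * 55 + 5 + 12 * D / ε)) := by
      gcongr
    have q4 : γ ^ 2 ≤ γ * (1 / 192) := by rw [sq]; gcongr
    have q5 : γ * (512 + 4 * (8 * 55 + 5 + 12 * D / ε)) = 2292 * γ + 4 * (γ * (12 * D / ε)) := by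
      ring
    rw [q5, q2] at q3
    refine (add_le_add (mul_le_mul_of_nonneg_left hlow (by norm_num : (0:ℝ) ≤ 2)) q3).trans ?_
    linarith
  have hXm : ∀ y, MeasurableSet {p | Xr n p ≤ y} := fun y =>
    measurableSet_le (by fun_prop) (by fun_prop)
  have hri : ∀ x1, Integrable (fun p => ramp x1 l (Xr n p)) ρ := fun x1 =>
    Integrable.of_bound ((ramp_continuous x1 l).measurable.comp
      (Xr_measurable n)).aestronglyMeasurable 1 (ae_of_all _ fun p => by
        rw [Real.norm_of_nonneg (ramp_nonneg _ _ _)]; exact ramp_le_one _ _ _)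
  have hpi : ∀ x1, Integrable (fun t => ramp x1 l t *
      (Real.exp (-t ^ 2 / 2) / Real.sqrt (2 * Real.pi))) := fun x1 =>
    phi_integrable.bdd_mul (c := 1) (ramp_continuous x1 l).aestronglyMeasurable
      (ae_of_all _ fun p => by
        rw [Real.norm_of_nonneg (ramp_nonneg _ _ _)]; exact ramp_le_one _ _ _)
  have hΦi : ∀ y, Φ y = ∫ t, Set.indicator (Set.Iic y) 1 t *
      (Real.exp (-t ^ 2 / 2) / Real.sqrt (2 * Real.pi)) := by
    intro y
    unfold Φ
    rw [← integral_indicator measurableSet_Iic]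
    congr 1; ext t
    by_cases ht : t ∈ Set.Iic y <;> simp [ht]
  have hΦint : ∀ y, Integrable (fun t => Set.indicator (Set.Iic y) (1 : ℝ → ℝ) t *
      (Real.exp (-t ^ 2 / 2) / Real.sqrt (2 * Real.pi))) := by
    intro y
    refine (phi_integrable.indicator (measurableSet_Iic (a := y))).congr (ae_of_all _ fun t => ?_)
    by_cases ht : t ∈ Set.Iic y <;> simp [ht]
  have hind : ∀ x1 w, Set.indicator (Set.Iic x1) (1 : ℝ → ℝ) w ≤ ramp x1 l w := by
    intro x1 w
    by_cases hw : w ∈ Set.Iic x1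
    · rw [Set.indicator_of_mem hw, ramp_left hl0 hw]; rfl
    · rw [Set.indicator_of_notMem hw]; exact ramp_nonneg _ _ _
  have hind2 : ∀ x1 w, ramp x1 l w ≤ Set.indicator (Set.Iic (x1 + l)) (1 : ℝ → ℝ) w := by
    intro x1 w
    by_cases hw : w ∈ Set.Iic (x1 + l)
    · rw [Set.indicator_of_mem hw]; exact ramp_le_one _ _ _
    · rw [Set.indicator_of_notMem hw, ramp_right hl0]
      simp only [Set.mem_Iic, not_le] at hw; exact hw.le
  have hGint : ∀ y, Integrable (fun p => Set.indicator (Set.Iic y) (1 : ℝ → ℝ) (Xr n p)) ρ := by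
    intro y
    exact (integrable_const (1:ℝ)).indicator (hXm y)
  have hG : ∀ y, ρ.real {p | Xr n p ≤ y} = ∫ p, Set.indicator (Set.Iic y) (1 : ℝ → ℝ) (Xr n p) ∂ρ := by
    intro y
    rw [← integral_indicator_one (hXm y)]
    rfl
  have up1 : ρ.real {p | Xr n p ≤ x} ≤ ∫ p, ramp x l (Xr n p) ∂ρ := by
    rw [hG]; exact integral_mono (hGint x) (hri x) fun p => hind x _
  have up2 : ∫ t, ramp x l t * (Real.exp (-t ^ 2 / 2) / Real.sqrt (2 * Real.pi)) ≤ Φ (x + l) := by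
    rw [hΦi]; exact integral_mono (hpi x) (hΦint _) fun t =>
      mul_le_mul_of_nonneg_right (hind2 x t) (phi_nonneg t)
  have lo1 : ∫ p, ramp (x - l) l (Xr n p) ∂ρ ≤ ρ.real {p | Xr n p ≤ x} := by
    rw [hG]
    refine integral_mono (hri _) (hGint x) fun p => ?_
    have := hind2 (x - l) (Xr n p)
    rwa [sub_add_cancel] at this
  have lo2 : Φ (x - l) ≤ ∫ t, ramp (x - l) l t * (Real.exp (-t ^ 2 / 2) / Real.sqrt (2 * Real.pi)) := by
    rw [hΦi]; exact integral_mono (hΦint _) (hpi _) fun t =>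
      mul_le_mul_of_nonneg_right (hind _ t) (phi_nonneg t)
  have c1 := Phi_close x (x + l) ε hε2 (by rw [add_sub_cancel_left, abs_of_pos hl0])
  have c2 := Phi_close x (x - l) ε hε2 (by rw [sub_sub_cancel_left, abs_neg, abs_of_pos hl0])
  have e1 := herr x (by linarith) le_rfl
  have e2 := herr (x - l) le_rfl (by linarith)
  rw [abs_le] at c1 c2 e1 e2 ⊢
  constructor <;> linarith [c1.1, c1.2, c2.1, c2.2, e1.1, e1.2, e2.1, e2.2]

lemma be_reg (ν : Measure ℝ) [IsProbabilityMeasure ν] (n : ℕ)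
    (h1i : Integrable (fun t : ℝ => t) ν) (h1 : ∫ t, t ∂ν = 0)
    (h2i : Integrable (fun t : ℝ => t ^ 2) ν) (h2 : ∫ t, t ^ 2 ∂ν = 1 / (n + 1 : ℝ))
    (h3 : Integrable (fun t : ℝ => |t| ^ 3) ν)
    (γ : ℝ) (hγ : 0 < γ) (hγ3 : (n + 1 : ℝ) * ∫ t, |t| ^ 3 ∂ν ≤ γ)
    (hγ1 : 1 / Real.sqrt (n + 1) ≤ γ) (x : ℝ) :
    |(Measure.pi fun _ : Fin (n + 1) => ν).real {ω | sm ω / Ureg (sq2 ω) ≤ x} - Φ x| ≤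
      5000 * γ := by
  have e := exch_measure ν n {q : ℝ × ℝ | q.1 / Ureg q.2 ≤ x}
      (measurableSet_le (by fun_prop) (by fun_prop))
  simp only [Set.mem_ofPred_eq] at e
  rw [e]
  change |(ν.prod (Measure.pi fun _ : Fin n => ν)).real {p | Xr n p ≤ x} - Φ x| ≤ _
  have h1' : ∀ y, |(ν.prod (Measure.pi fun _ : Fin n => ν)).real {p | Xr n p ≤ y} - Φ y| ≤ 1 := by
    intro y
    have a1 : (ν.prod (Measure.pi fun _ : Fin n => ν)).real {p | Xr n p ≤ y} ≤ 1 := measureReal_le_one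
    have a0 : 0 ≤ (ν.prod (Measure.pi fun _ : Fin n => ν)).real {p | Xr n p ≤ y} := measureReal_nonneg
    have := Phi_nonneg y
    have := Phi_le_one y
    rw [abs_le]; constructor <;> linarith
  by_cases hγs : γ ≤ 1 / 192
  · set F : ℝ → ℝ := fun y =>
      |(ν.prod (Measure.pi fun _ : Fin n => ν)).real {p | Xr n p ≤ y} - Φ y| with hF
    have hb : BddAbove (Set.range F) := ⟨1, by rintro _ ⟨y, rfl⟩; exact h1' y⟩
    have hle : ∀ y, F y ≤ ⨆ y, F y := fun y => le_ciSup hb y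
    have h0 : 0 ≤ ⨆ y, F y := (abs_nonneg _).trans (hle 0)
    have hs := self_bound ν n h1i h1 h2i h2 h3 γ hγ hγ3 hγ1 hγs (⨆ y, F y) h0 hle
    have : (⨆ y, F y) ≤ 2500 * γ + (⨆ y, F y) / 2 := ciSup_le hs
    have := hle x
    linarith
  · have := h1' x
    push Not at hγs
    linarith


/-- monotone reparametrization between Student and self-normalized statistics -/
def gs (c u : ℝ) : ℝ := u / Real.sqrt (1 + c * u ^ 2)

lemma gs_strictMono (c : ℝ) (hc : 0 ≤ c) : StrictMono (gs c) := by
  apply strictMono_of_odd_strictMonoOn_nonneg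
  · intro u; simp only [gs, neg_sq, neg_div]
  · intro a ha b hb hab
    simp only [Set.mem_Ici] at ha hb
    unfold gs
    have h1 : 0 < 1 + c * a ^ 2 := by positivity
    have h2 : 0 < 1 + c * b ^ 2 := by positivity
    rw [div_lt_div_iff₀ (by positivity) (by positivity)]
    apply lt_of_pow_lt_pow_left₀ 2 (by positivity)
    rw [mul_pow, mul_pow, Real.sq_sqrt h1.le, Real.sq_sqrt h2.le]
    have : a ^ 2 < b ^ 2 := by gcongr
    nlinarith

lemma studentized_eq (m : ℕ) (hm : 0 < m) (y : Fin m → ℝ) :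
    studentized m y = sm y / Real.sqrt (sq2 y - sm y ^ 2 / m) := by
  have hm' : (0:ℝ) < m := by exact_mod_cast hm
  unfold studentized
  have e : ∑ i, (y i - (∑ j, y j) / m) ^ 2 = sq2 y - sm y ^ 2 / m := by
    simp only [sub_sq, Finset.sum_add_distrib, Finset.sum_sub_distrib]
    rw [← Finset.sum_mul, ← Finset.mul_sum]
    simp only [Finset.sum_const, Finset.card_univ, Fintype.card_fin, nsmul_eq_mul, sm, sq2]
    field_simp
    ring
  rw [e, Real.sqrt_div' _ hm'.le]
  have hs : 0 < Real.sqrt (m:ℝ) := Real.sqrt_pos.2 hm'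
  change Real.sqrt m * (sm y / m) / _ = _
  rw [div_div_eq_mul_div]
  congr 1
  have : Real.sqrt (m:ℝ) * Real.sqrt m = m := Real.mul_self_sqrt hm'.le
  calc Real.sqrt (m:ℝ) * (sm y / m) * Real.sqrt m
      = sm y * ((Real.sqrt (m:ℝ) * Real.sqrt m) / m) := by ring
    _ = sm y := by rw [this, div_self hm'.ne', mul_one]

lemma stud_iff (m : ℕ) (hm : 0 < m) (y : Fin m → ℝ) (z : ℝ)
    (hQ : 1 / 4 ≤ sq2 y) (hV : sm y ^ 2 < m * sq2 y) :
    studentized m y ≤ z ↔ sm y / Ureg (sq2 y) ≤ gs (1 / m) z := by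
  have hm' : (0:ℝ) < m := by exact_mod_cast hm
  have hVp : 0 < sq2 y - sm y ^ 2 / m := by
    rw [sub_pos, div_lt_iff₀ hm']; linarith
  rw [← (gs_strictMono (1 / m) (by positivity)).le_iff_le, studentized_eq m hm]
  have e : gs (1 / m) (sm y / Real.sqrt (sq2 y - sm y ^ 2 / m)) = sm y / Ureg (sq2 y) := by
    unfold gs Ureg
    rw [max_eq_left hQ, div_pow, Real.sq_sqrt hVp.le]
    have e2 : 1 + 1 / (m:ℝ) * (sm y ^ 2 / (sq2 y - sm y ^ 2 / m))
        = sq2 y / (sq2 y - sm y ^ 2 / m) := by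
      rw [eq_div_iff hVp.ne', add_mul, mul_assoc, div_mul_cancel₀ _ hVp.ne']; ring
    rw [e2, Real.sqrt_div' _ hVp.le]
    have h1 : 0 < Real.sqrt (sq2 y - sm y ^ 2 / m) := Real.sqrt_pos.2 hVp
    rw [div_div_div_cancel_right₀ h1.ne']
  rw [e]

lemma exp_tail (w : ℝ) (hw : w ≠ 0) : Real.exp (-w ^ 2 / 2) ≤ 2 / w ^ 2 := by
  have h := Real.add_one_le_exp (w ^ 2 / 2)
  have hp : 0 < w ^ 2 := by positivity
  rw [neg_div, Real.exp_neg, inv_le_comm₀ (Real.exp_pos _) (by positivity), inv_div]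
  linarith

lemma one_le_s2pi : 1 ≤ Real.sqrt (2 * Real.pi) := by
  rw [Real.one_le_sqrt]; linarith [Real.pi_gt_three]

lemma Phi_tail_neg (w : ℝ) (hw : 0 < w) : Φ (-w) ≤ 6 / w ^ 2 := by
  unfold Φ
  rw [integral_div, gexp_Iic, neg_neg]
  have h := mills1 w hw.le
  have h2 := exp_tail w hw.ne'
  have h0 : 0 ≤ ∫ t in Set.Ioi w, Real.exp (-t ^ 2 / 2) := integral_nonneg fun t => (Real.exp_pos _).le
  refine (div_le_self h0 one_le_s2pi).trans (h.trans ?_)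
  calc 3 * Real.exp (-w ^ 2 / 2) ≤ 3 * (2 / w ^ 2) := by gcongr
    _ = _ := by ring

lemma Phi_tail_pos (w : ℝ) (hw : 0 < w) : 1 - Φ w ≤ 6 / w ^ 2 := by
  have e : 1 - Φ w = (∫ t in Set.Ioi w, Real.exp (-t ^ 2 / 2)) / Real.sqrt (2 * Real.pi) := by
    unfold Φ
    rw [← phi_integral, ← integral_div,
      ← intervalIntegral.integral_Iic_add_Ioi phi_integrable.integrableOn phi_integrable.integrableOn (b := w)]
    ring
  rw [e]
  have h := mills1 w hw.le
  have h2 := exp_tail w hw.ne'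
  have h0 : 0 ≤ ∫ t in Set.Ioi w, Real.exp (-t ^ 2 / 2) := integral_nonneg fun t => (Real.exp_pos _).le
  refine (div_le_self h0 one_le_s2pi).trans (h.trans ?_)
  calc 3 * Real.exp (-w ^ 2 / 2) ≤ 3 * (2 / w ^ 2) := by gcongr
    _ = _ := by ring

lemma Phi_gs (m : ℕ) (hm : 0 < m) (z : ℝ) :
    |Φ z - Φ (gs (1 / m) z)| ≤ 12 / Real.sqrt m := by
  have hm' : (0:ℝ) < m := by exact_mod_cast hm
  have hm1 : (1:ℝ) ≤ m := by exact_mod_cast hm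
  set q := Real.sqrt m with hq
  have hq1 : 1 ≤ q := by rw [hq, Real.one_le_sqrt]; exact hm1
  have hqq : q ^ 2 = m := Real.sq_sqrt hm'.le
  set s := Real.sqrt (1 + 1 / m * z ^ 2) with hs
  have hs2 : s ^ 2 = 1 + 1 / m * z ^ 2 := Real.sq_sqrt (by positivity)
  have hs0 : 0 < s := Real.sqrt_pos.2 (by positivity)
  have hs1 : 1 ≤ s := by
    rw [hs, Real.one_le_sqrt]
    have : 0 ≤ 1 / (m:ℝ) * z ^ 2 := by positivity
    linarith
  set x := gs (1 / m) z with hx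
  have hxs : x * s = z := by
    rw [hx]; unfold gs; exact div_mul_cancel₀ _ hs0.ne'
  have hsz : z ^ 2 = q ^ 2 * (s ^ 2 - 1) := by rw [hs2, hqq]; field_simp; ring
  by_cases hz : z ^ 2 ≤ q
  · have h1 : s - 1 ≤ 1 / (2 * q) := by
      rw [le_div_iff₀ (by positivity)]
      have : q * (s ^ 2 - 1) ≤ 1 := by
        have : q * (q * (s ^ 2 - 1)) ≤ q * 1 := by nlinarith
        exact le_of_mul_le_mul_left this (by linarith)
      nlinarith [mul_nonneg (by linarith : 0 ≤ q) (mul_self_nonneg (s - 1))]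
    have h2 := Phi_close x z (1 / (2 * q)) (by
      rw [div_le_div_iff₀ (by positivity) (by norm_num)]; linarith) (by
        have e : z - x = x * (s - 1) := by rw [mul_sub, hxs]; ring
        rw [e, abs_mul, abs_of_nonneg (by linarith : 0 ≤ s - 1), mul_comm]
        exact mul_le_mul h1 (by linarith) (abs_nonneg _) (by positivity))
    refine h2.trans ?_
    rw [mul_one_div, div_le_div_iff₀ (by positivity) (by positivity)]
    nlinarith
  · push Not at hz
    have hx2 : q / 2 ≤ x ^ 2 := by
      have e : x ^ 2 * s ^ 2 = z ^ 2 := by rw [← mul_pow, hxs]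
      have hsle : s ^ 2 * q ≤ 2 * z ^ 2 := by
        have e3 : s ^ 2 = 1 + z ^ 2 / q ^ 2 := by rw [hs2, hqq]; ring
        have e4 : z ^ 2 / q ^ 2 * q ≤ z ^ 2 := by
          rw [div_mul_eq_mul_div, div_le_iff₀ (by positivity)]
          have : 0 ≤ z ^ 2 := sq_nonneg z
          nlinarith [mul_nonneg this (mul_nonneg (by linarith : 0 ≤ q) (by linarith : 0 ≤ q - 1))]
        rw [e3, add_mul]; linarith
      have : s ^ 2 * (q / 2) ≤ s ^ 2 * x ^ 2 := by linarith
      exact le_of_mul_le_mul_left this (by positivity)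
    have hz2 : q / 2 ≤ z ^ 2 := by linarith
    have tl : ∀ w : ℝ, q / 2 ≤ w ^ 2 → 6 / w ^ 2 ≤ 12 / q := by
      intro w hw
      have : 0 < w ^ 2 := by linarith
      rw [div_le_div_iff₀ this (by linarith)]; linarith
    have hzne : z ≠ 0 := by rintro rfl; norm_num at hz2; linarith
    have z0 := Phi_nonneg z
    have z1 := Phi_le_one z
    have x0 := Phi_nonneg x
    have x1 := Phi_le_one x
    rcases lt_or_gt_of_ne hzne with hz0 | hz0
    · have hx0 : x < 0 := by
        by_contra h; push Not at h
        have := mul_nonneg h hs0.le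
        linarith
      have a := (Phi_tail_neg (-z) (by linarith)).trans (tl (-z) (by rwa [neg_sq]))
      have b := (Phi_tail_neg (-x) (by linarith)).trans (tl (-x) (by rwa [neg_sq]))
      rw [neg_neg] at a b
      rw [abs_le]; constructor <;> linarith
    · have hx0 : 0 < x := by
        by_contra h; push Not at h
        have := mul_nonpos_of_nonpos_of_nonneg h hs0.le
        linarith
      have a := (Phi_tail_pos z hz0).trans (tl z hz2)
      have b := (Phi_tail_pos x hx0).trans (tl x hx2)
      rw [abs_le]; constructor <;> linarith

lemma be_stud (ν : Measure ℝ) [IsProbabilityMeasure ν] (m : ℕ) (hm : 0 < m)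
    (h1i : Integrable (fun t : ℝ => t) ν) (h1 : ∫ t, t ∂ν = 0)
    (h2i : Integrable (fun t : ℝ => t ^ 2) ν) (h2 : ∫ t, t ^ 2 ∂ν = 1 / (m : ℝ))
    (h3 : Integrable (fun t : ℝ => |t| ^ 3) ν)
    (γ : ℝ) (hγ : 0 < γ) (hγ3 : (m : ℝ) * ∫ t, |t| ^ 3 ∂ν ≤ γ)
    (hγ1 : 1 / Real.sqrt m ≤ γ) (z : ℝ) :
    |(Measure.pi fun _ : Fin m => ν).real {ω | studentized m ω ≤ z} - Φ z| ≤
      5100 * γ := by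
  set μ := Measure.pi fun _ : Fin m => ν with hμ
  have hm' : (0:ℝ) < m := by exact_mod_cast hm
  have hreg : ∀ x, |μ.real {ω | sm ω / Ureg (sq2 ω) ≤ x} - Φ x| ≤ 5000 * γ := by
    obtain ⟨n, rfl⟩ : ∃ n, m = n + 1 := ⟨m - 1, by omega⟩
    push_cast at h2 hγ3 hγ1
    intro x
    exact be_reg ν n h1i h1 h2i h2 h3 γ hγ hγ3 hγ1 x
  by_cases hγb : γ ≤ 1
  · have hlow := lower_tail ν m hm h2 h3 h2i γ hγ hγ3
    have hL2 : MemLp (fun t : ℝ => t) 2 ν :=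
      (memLp_two_iff_integrable_sq (by fun_prop)).2 h2i
    obtain ⟨iA, eA⟩ := sm_sq ν m h1 hL2
    have hmk := mul_meas_ge_le_integral_of_nonneg (μ := μ) (f := fun ω : Fin m → ℝ => sm ω ^ 2)
      (ae_of_all _ fun t => sq_nonneg _) iA (m / 4)
    rw [eA, h2, mul_one_div, div_self hm'.ne'] at hmk
    have hmk' : μ.real {ω | (m:ℝ) / 4 ≤ sm ω ^ 2} ≤ 4 / m := by
      rw [le_div_iff₀ hm']
      change (m:ℝ) / 4 * μ.real {ω | (m:ℝ) / 4 ≤ sm ω ^ 2} ≤ 1 at hmk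
      linarith
    have hmγ : 1 / (m:ℝ) ≤ γ ^ 2 := by
      have : 1 / (m:ℝ) = (1 / Real.sqrt m) ^ 2 := by rw [div_pow, Real.sq_sqrt hm'.le, one_pow]
      rw [this]; gcongr
    have hbad : μ.real ({ω | sq2 ω < 1 / 4} ∪ {ω | (m:ℝ) / 4 ≤ sm ω ^ 2}) ≤ 20 * γ := by
      refine (measureReal_union_le _ _).trans ?_
      have e : 4 / (m:ℝ) = 4 * (1 / m) := by ring
      have : γ ^ 2 ≤ γ := by nlinarith
      rw [e] at hmk'
      change μ.real {ω | sq2 ω < 1 / 4} ≤ _ at hlow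
      linarith
    have hgood : ∀ ω : Fin m → ℝ, ω ∉ ({ω | sq2 ω < 1 / 4} ∪ {ω | (m:ℝ) / 4 ≤ sm ω ^ 2}) →
        (studentized m ω ≤ z ↔ sm ω / Ureg (sq2 ω) ≤ gs (1 / m) z) := by
      intro ω hω
      simp only [Set.mem_union, Set.mem_ofPred_eq, not_or, not_lt, not_le] at hω
      refine stud_iff m hm ω z hω.1 (hω.2.trans_le ?_)
      have := mul_le_mul_of_nonneg_left hω.1 hm'.le
      linarith
    set B := {ω : Fin m → ℝ | sq2 ω < 1 / 4} ∪ {ω | (m:ℝ) / 4 ≤ sm ω ^ 2} with hB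
    have i1 : μ.real {ω | studentized m ω ≤ z} ≤ μ.real {ω | sm ω / Ureg (sq2 ω) ≤ gs (1 / m) z}
        + μ.real B := by
      refine (measureReal_mono ?_ (measure_ne_top _ _)).trans (measureReal_union_le _ _)
      intro ω hω
      by_cases hb : ω ∈ B
      · exact Or.inr hb
      · exact Or.inl ((hgood ω hb).1 hω)
    have i2 : μ.real {ω | sm ω / Ureg (sq2 ω) ≤ gs (1 / m) z} ≤ μ.real {ω | studentized m ω ≤ z}
        + μ.real B := by
      refine (measureReal_mono ?_ (measure_ne_top _ _)).trans (measureReal_union_le _ _)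
      intro ω hω
      by_cases hb : ω ∈ B
      · exact Or.inr hb
      · exact Or.inl ((hgood ω hb).2 hω)
    have a := hreg (gs (1 / m) z)
    have b := Phi_gs m hm z
    have e : 12 / Real.sqrt m = 12 * (1 / Real.sqrt m) := by ring
    rw [e] at b
    rw [abs_le] at a b ⊢
    constructor <;> linarith [a.1, a.2, b.1, b.2]
  · have a1 : μ.real {ω | studentized m ω ≤ z} ≤ 1 := measureReal_le_one
    have a0 : 0 ≤ μ.real {ω | studentized m ω ≤ z} := measureReal_nonneg
    have := Phi_nonneg z
    have := Phi_le_one z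
    push Not at hγb
    rw [abs_le]; constructor <;> linarith

/-- Scaling-free version. -/
lemma be_stud_scaled (ν : Measure ℝ) [IsProbabilityMeasure ν] (m : ℕ) (hm : 0 < m) (K : ℝ)
    (hK : 1 < K)
    (h1i : Integrable (fun t : ℝ => t) ν) (h1 : ∫ t, t ∂ν = 0)
    (h2i : Integrable (fun t : ℝ => t ^ 2) ν) (σ : ℝ) (hσ : 0 < σ) (h2 : ∫ t, t ^ 2 ∂ν = σ ^ 2)
    (h3 : Integrable (fun t : ℝ => |t| ^ 3) ν) (h3b : ∫ t, |t| ^ 3 ∂ν ≤ (K * σ) ^ 3) (z : ℝ) :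
    |(Measure.pi fun _ : Fin m => ν).real {ω | studentized m ω ≤ z} - Φ z| ≤
      5100 * K ^ 3 / Real.sqrt m := by
  have hm' : (0:ℝ) < m := by exact_mod_cast hm
  set q := Real.sqrt m with hq
  have hq0 : 0 < q := Real.sqrt_pos.2 hm'
  have hqq : q ^ 2 = m := Real.sq_sqrt hm'.le
  set a := 1 / (σ * q) with ha
  have ha0 : 0 < a := by positivity
  have hf : Measurable (fun t : ℝ => a * t) := by fun_prop
  set ν' := ν.map (fun t : ℝ => a * t) with hν'
  have : IsProbabilityMeasure ν' := Measure.isProbabilityMeasure_map hf.aemeasurable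
  have hme : MeasurableEmbedding (fun t : ℝ => a * t) :=
    (Homeomorph.mulLeft₀ a ha0.ne').measurableEmbedding
  have ei : ∀ g : ℝ → ℝ, ∫ t, g t ∂ν' = ∫ t, g (a * t) ∂ν := fun g => hme.integral_map g
  have ii : ∀ g : ℝ → ℝ, Integrable (fun t => g (a * t)) ν → Integrable g ν' := fun g hg =>
    hme.integrable_map_iff.2 hg
  have key := be_stud ν' m hm
    (ii (fun t => t) (h1i.const_mul a))
    (by rw [ei (fun t => t), integral_const_mul, h1, mul_zero])
    (ii (fun t => t ^ 2) (by simp only [mul_pow]; exact h2i.const_mul _))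
    (by
      rw [ei (fun t => t ^ 2)]
      simp only [mul_pow]
      rw [integral_const_mul, h2, ha, div_pow, mul_pow, hqq]
      field_simp)
    (ii (fun t => |t| ^ 3) (by simp only [abs_mul, mul_pow]; exact h3.const_mul _))
    (K ^ 3 / q) (by positivity)
    (by
      rw [ei (fun t => |t| ^ 3)]
      simp only [abs_mul, mul_pow]
      rw [integral_const_mul, abs_of_pos ha0]
      calc (m:ℝ) * (a ^ 3 * ∫ t, |t| ^ 3 ∂ν) ≤ m * (a ^ 3 * (K * σ) ^ 3) := by gcongr
        _ = K ^ 3 / q := by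
          rw [← hqq, ha]; field_simp)
    (by
      apply div_le_div_of_nonneg_right _ hq0.le
      exact one_le_pow₀ hK.le) z
  have hpi : Measure.pi (fun _ : Fin m => ν') =
      (Measure.pi fun _ : Fin m => ν).map (fun ω i => a * ω i) := by
    rw [hν', Measure.pi_map_pi (fun _ => hf.aemeasurable)]
  have hstudm : Measurable (fun ω : Fin m → ℝ => studentized m ω) := by
    unfold studentized; fun_prop
  rw [hpi, map_measureReal_apply (by fun_prop) (measurableSet_le hstudm measurable_const)] at key
  have es : ∀ ω : Fin m → ℝ, studentized m (fun i => a * ω i) = studentized m ω := by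
    intro ω
    rw [studentized_eq m hm, studentized_eq m hm]
    have e1 : sm (fun i => a * ω i) = a * sm ω := by simp only [sm, Finset.mul_sum]
    have e2 : sq2 (fun i => a * ω i) = a ^ 2 * sq2 ω := by simp only [sq2, Finset.mul_sum, mul_pow]
    have e3 : a ^ 2 * sq2 ω - (a * sm ω) ^ 2 / m = a ^ 2 * (sq2 ω - sm ω ^ 2 / m) := by ring
    rw [e1, e2, e3, Real.sqrt_mul (sq_nonneg a), Real.sqrt_sq ha0.le,
      mul_div_mul_left _ _ ha0.ne']
  simp only [Set.preimage_ofPred_eq, es] at key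
  rw [mul_div_assoc]
  exact key


lemma dot_add_left {d : ℕ} (a b x : Fin d → ℝ) : dot (a + b) x = dot a x + dot b x := by
  simp only [dot, Pi.add_apply, add_mul, Finset.sum_add_distrib]

lemma dot_smul_left {d : ℕ} (c : ℝ) (a x : Fin d → ℝ) : dot (c • a) x = c * dot a x := by
  simp only [dot, Pi.smul_apply, smul_eq_mul, Finset.mul_sum, mul_assoc]

lemma dot_comm' {d : ℕ} (a x : Fin d → ℝ) : dot a x = dot x a := by
  simp only [dot, mul_comm]

lemma dot_self_pos {d : ℕ} (v : Fin d → ℝ) (hv : v ≠ 0) : 0 < dot v v := by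
  obtain ⟨i, hi⟩ := Function.ne_iff.1 hv
  unfold dot
  apply Finset.sum_pos' (fun j _ => mul_self_nonneg _)
  exact ⟨i, Finset.mem_univ i, mul_self_pos.2 hi⟩

@[fun_prop]
lemma dot_measurable {d : ℕ} (v : Fin d → ℝ) : Measurable (fun x => dot v x) := by
  unfold dot; fun_prop

lemma lyap_moments {d : ℕ} (P : Measure (Fin d → ℝ)) (K : ℝ) (hK : 1 < K)
    (hP : LyapunovAssumption P 0 K) (v : Fin d → ℝ) (hv : v ≠ 0) :
    Integrable (fun x => dot v x) P ∧ ∫ x, dot v x ∂P = 0 ∧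
    Integrable (fun x => dot v x ^ 2) P ∧ Integrable (fun x => |dot v x| ^ 3) P ∧
    ∫ x, |dot v x| ^ 3 ∂P ≤ (K * Real.sqrt (∫ x, dot v x ^ 2 ∂P)) ^ 3 := by
  obtain ⟨hprob, hat, hint, hmean, hL⟩ := hP
  have hi : ∀ i, Integrable (fun x : Fin d → ℝ => v i * x i) P := fun i => (hint i).const_mul _
  have a1 : Integrable (fun x => dot v x) P := by
    unfold dot
    exact integrable_finsetSum _ fun i _ => hi i
  have a2 : ∫ x, dot v x ∂P = 0 := by
    unfold dot
    rw [integral_finsetSum _ fun i _ => hi i]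
    simp [integral_const_mul, hmean]
  have hvv := dot_self_pos v hv
  set c := Real.sqrt (dot v v) with hc
  have hc0 : 0 < c := Real.sqrt_pos.2 hvv
  have hcc : c ^ 2 = dot v v := Real.sq_sqrt hvv.le
  obtain ⟨u1, u2⟩ := hL (c⁻¹ • v) (by
    rw [dot_smul_left, dot_comm', dot_smul_left, ← hcc]; field_simp)
  simp only [Pi.zero_apply, sub_zero, dot_smul_left] at u1 u2
  have hci : 0 < c⁻¹ := by positivity
  simp only [abs_mul, mul_pow, integral_const_mul, abs_of_pos hci] at u1 u2
  have a4 : Integrable (fun x => |dot v x| ^ 3) P := by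
    have := u1.const_mul (c ^ 3)
    refine this.congr (ae_of_all _ fun x => ?_)
    simp only
    field_simp
  have a3 : Integrable (fun x => dot v x ^ 2) P := by
    refine ((integrable_const (1:ℝ)).add a4).mono' (Measurable.aestronglyMeasurable (by fun_prop))
      (ae_of_all _ fun x => ?_)
    rw [Real.norm_of_nonneg (sq_nonneg _), ← sq_abs]
    simp only [Pi.add_apply]
    have := abs_nonneg (dot v x)
    nlinarith [mul_nonneg this (sq_nonneg (|dot v x| - 1)), sq_nonneg (|dot v x| - 1)]
  refine ⟨a1, a2, a3, a4, ?_⟩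
  set I3 := ∫ x, |dot v x| ^ 3 ∂P with hI3
  set I2 := ∫ x, dot v x ^ 2 ∂P with hI2
  have hI30 : 0 ≤ I3 := integral_nonneg fun x => by positivity
  have hI20 : 0 ≤ I2 := integral_nonneg fun x => by positivity
  have hcube := pow_le_pow_left₀ (by positivity) u2 3
  rw [← Real.rpow_natCast, ← Real.rpow_mul (by positivity), ← Real.sqrt_eq_rpow,
    Real.sqrt_mul (sq_nonneg _), Real.sqrt_sq hci.le] at hcube
  norm_num at hcube
  have e : (K * (c⁻¹ * Real.sqrt I2)) ^ 3 = (c ^ 3)⁻¹ * (K * Real.sqrt I2) ^ 3 := by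
    rw [← inv_pow]; ring
  rw [e] at hcube
  exact le_of_mul_le_mul_left hcube (by positivity)

lemma slice_bound {d : ℕ} (P : Measure (Fin d → ℝ)) (K : ℝ) (hK : 1 < K)
    (hP : LyapunovAssumption P 0 K) (v : Fin d → ℝ) (hσ : 0 < ∫ x, dot v x ^ 2 ∂P)
    (m : ℕ) (hm : 0 < m) (z : ℝ) :
    |(Measure.pi fun _ : Fin m => P).real {a | studentized m (fun i => dot v (a i)) ≤ z} - Φ z|
      ≤ 5100 * K ^ 3 / Real.sqrt m := by
  have hv : v ≠ 0 := by
    rintro rfl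
    simp [dot] at hσ
  obtain ⟨a1, a2, a3, a4, a5⟩ := lyap_moments P K hK hP v hv
  have : IsProbabilityMeasure P := hP.1
  have hf : Measurable (fun x => dot v x) := dot_measurable v
  set ν := P.map (fun x => dot v x) with hν
  have : IsProbabilityMeasure ν := Measure.isProbabilityMeasure_map hf.aemeasurable
  have ei : ∀ g : ℝ → ℝ, Measurable g → ∫ t, g t ∂ν = ∫ x, g (dot v x) ∂P := fun g hg =>
    integral_map hf.aemeasurable hg.aestronglyMeasurable
  have ii : ∀ g : ℝ → ℝ, Measurable g → Integrable (fun x => g (dot v x)) P → Integrable g ν :=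
    fun g hg h => (integrable_map_measure hg.aestronglyMeasurable hf.aemeasurable).2 h
  have key := be_stud_scaled ν m hm K hK
    (ii (fun t => t) (by fun_prop) a1) (by rw [ei (fun t => t) (by fun_prop)]; exact a2)
    (ii (fun t => t ^ 2) (by fun_prop) a3)
    (Real.sqrt (∫ x, dot v x ^ 2 ∂P)) (Real.sqrt_pos.2 hσ)
    (by rw [ei (fun t => t ^ 2) (by fun_prop), Real.sq_sqrt hσ.le])
    (ii (fun t => |t| ^ 3) (by fun_prop) a4)
    (by rw [ei (fun t => |t| ^ 3) (by fun_prop)]; exact a5) z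
  have hpi : Measure.pi (fun _ : Fin m => ν) =
      (Measure.pi fun _ : Fin m => P).map (fun a i => dot v (a i)) := by
    rw [hν, Measure.pi_map_pi (fun _ => hf.aemeasurable)]
  have hstudm : Measurable (fun ω : Fin m → ℝ => studentized m ω) := by
    unfold studentized; fun_prop
  rw [hpi, map_measureReal_apply (by fun_prop) (measurableSet_le hstudm measurable_const)] at key
  exact key

lemma sum_ne_zero_ae {d : ℕ} (P : Measure (Fin d → ℝ)) [IsProbabilityMeasure P]
    (hat : ∀ x, P {x} = 0) (m : ℕ) (hm : 0 < m) :
    ∀ᵐ b ∂(Measure.pi fun _ : Fin m => P), ∑ k, b k ≠ 0 := by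
  obtain ⟨n, rfl⟩ : ∃ n, m = n + 1 := ⟨m - 1, by omega⟩
  have hmp := measurePreserving_piFinSuccAbove (fun _ : Fin (n + 1) => P) 0
  have hs : MeasurableSet {p : (Fin d → ℝ) × (Fin n → Fin d → ℝ) | p.1 + ∑ k, p.2 k = 0} :=
    measurableSet_eq_fun (by fun_prop) (by fun_prop)
  have h0 : (P.prod (Measure.pi fun _ : Fin n => P))
      {p : (Fin d → ℝ) × (Fin n → Fin d → ℝ) | p.1 + ∑ k, p.2 k = 0} = 0 := by
    rw [Measure.prod_apply_symm hs]
    rw [lintegral_eq_zero_iff (measurable_measure_prodMk_right hs)]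
    refine ae_of_all _ fun y => ?_
    have : (fun x => (x, y)) ⁻¹' {p : (Fin d → ℝ) × (Fin n → Fin d → ℝ) | p.1 + ∑ k, p.2 k = 0}
        = {-∑ k, y k} := by
      ext x
      simp only [Set.mem_preimage, Set.mem_ofPred_eq, Set.mem_singleton_iff]
      exact add_eq_zero_iff_eq_neg
    simp only [this, hat, Pi.zero_apply]
  have h1 := hmp.measure_preimage hs.nullMeasurableSet
  rw [ae_iff]
  simp only [not_not]
  refine Eq.trans ?_ (h1.trans h0)
  congr 1
  ext b
  simp only [Set.mem_ofPred_eq, Set.mem_preimage, Fin.sum_univ_succ]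
  rfl

lemma sigma_pos_ae {d : ℕ} (P : Measure (Fin d → ℝ)) (K : ℝ) (hK : 1 < K)
    (hP : LyapunovAssumption P 0 K) (m : ℕ) (hm : 0 < m) :
    ∀ᵐ b ∂(Measure.pi fun _ : Fin m => P),
      0 < ∫ x, dot (fun j => (∑ k : Fin m, b k j) / m) x ^ 2 ∂P := by
  have : IsProbabilityMeasure P := hP.1
  have hm' : (0:ℝ) < m := by exact_mod_cast hm
  let N : Submodule ℝ (Fin d → ℝ) :=
    { carrier := {w | ∀ᵐ x ∂P, dot w x = 0}
      add_mem' := by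
        intro a b ha hb
        change ∀ᵐ x ∂P, dot (a + b) x = 0
        change ∀ᵐ x ∂P, dot a x = 0 at ha
        change ∀ᵐ x ∂P, dot b x = 0 at hb
        filter_upwards [ha, hb] with x h1 h2
        rw [dot_add_left, h1, h2, add_zero]
      zero_mem' := ae_of_all _ fun x => by simp [dot]
      smul_mem' := by
        intro c a ha
        change ∀ᵐ x ∂P, dot (c • a) x = 0
        change ∀ᵐ x ∂P, dot a x = 0 at ha
        filter_upwards [ha] with x h1
        rw [dot_smul_left, h1, mul_zero] }
  obtain ⟨S, hS⟩ := IsNoetherian.noetherian N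
  have hae : ∀ᵐ x ∂P, ∀ w ∈ N, dot w x = 0 := by
    have h1 : ∀ᵐ x ∂P, ∀ w ∈ S, dot w x = 0 := by
      rw [Filter.eventually_all_finset]
      intro w hw
      have : w ∈ N := by rw [← hS]; exact Submodule.subset_span hw
      exact this
    filter_upwards [h1] with x hx w hw
    rw [← hS] at hw
    induction hw using Submodule.span_induction with
    | mem w h => exact hx w h
    | zero => simp [dot]
    | add a b _ _ h1 h2 => rw [dot_add_left, h1, h2, add_zero]
    | smul c a _ h1 => rw [dot_smul_left, h1, mul_zero]
  have hall : ∀ᵐ b ∂(Measure.pi fun _ : Fin m => P), ∀ k, ∀ w ∈ N, dot w (b k) = 0 := by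
    rw [ae_all_iff]
    intro k
    exact (Measure.quasiMeasurePreserving_eval (μ := fun _ : Fin m => P) k).ae hae
  filter_upwards [hall, sum_ne_zero_ae P hP.2.1 m hm] with b hb hne
  set v : Fin d → ℝ := fun j => (∑ k : Fin m, b k j) / m with hv
  have hve : v = (m:ℝ)⁻¹ • ∑ k, b k := by
    ext j
    simp only [hv, Pi.smul_apply, Finset.sum_apply, smul_eq_mul]
    rw [div_eq_inv_mul]
  have hv0 : v ≠ 0 := by
    rw [hve]; exact smul_ne_zero (by positivity) hne
  obtain ⟨-, -, a3, -, -⟩ := lyap_moments P K hK hP v hv0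
  have hnn : 0 ≤ ∫ x, dot v x ^ 2 ∂P := integral_nonneg fun x => sq_nonneg _
  refine lt_of_le_of_ne hnn fun h => ?_
  have h0 := (integral_eq_zero_iff_of_nonneg (fun x => sq_nonneg _) a3).1 h.symm
  have hvN : v ∈ N := by
    change ∀ᵐ x ∂P, dot v x = 0
    filter_upwards [h0] with x hx
    simpa using hx
  have hvv : dot v v = 0 := by
    have hsum : dot v (∑ k, b k) = 0 := by
      have : dot v (∑ k, b k) = ∑ k, dot v (b k) := by
        simp only [dot, Finset.sum_apply, Finset.mul_sum]
        exact Finset.sum_comm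
      rw [this]; exact Finset.sum_eq_zero fun k _ => hb k v hvN
    have : dot v v = (m:ℝ)⁻¹ * dot v (∑ k, b k) := by
      conv_lhs => rw [hve, dot_smul_left, dot_comm', ← hve]
    rw [this, hsum, mul_zero]
  exact absurd hvv (dot_self_pos v hv0).ne'

lemma pi_append {E : Type*} [MeasurableSpace E] (P : Measure E) [IsProbabilityMeasure P]
    (m₁ m₂ : ℕ) :
    ((Measure.pi fun _ : Fin m₂ => P).prod (Measure.pi fun _ : Fin m₁ => P)).map
      (fun p => Fin.append p.2 p.1) = Measure.pi fun _ : Fin (m₁ + m₂) => P := by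
  have hmeas : Measurable (fun p : (Fin m₂ → E) × (Fin m₁ → E) => Fin.append p.2 p.1) := by
    rw [measurable_pi_iff]
    intro i
    refine Fin.addCases (fun j => ?_) (fun j => ?_) i
    · simp only [Fin.append_left]; fun_prop
    · simp only [Fin.append_right]; fun_prop
  symm
  apply Measure.pi_eq
  intro s hs
  rw [Measure.map_apply hmeas (MeasurableSet.univ_pi hs)]
  have e : (fun p : (Fin m₂ → E) × (Fin m₁ → E) => Fin.append p.2 p.1) ⁻¹' Set.pi Set.univ s
      = (Set.pi Set.univ fun k => s (Fin.natAdd m₁ k)) ×ˢ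
        (Set.pi Set.univ fun k => s (Fin.castAdd m₂ k)) := by
    ext p
    simp only [Set.mem_preimage, Set.mem_pi, Set.mem_univ, true_imp_iff, Set.mem_prod]
    constructor
    · intro h
      exact ⟨fun k => by simpa using h (Fin.natAdd m₁ k), fun k => by simpa using h (Fin.castAdd m₂ k)⟩
    · rintro ⟨h1, h2⟩ i
      refine Fin.addCases (fun j => ?_) (fun j => ?_) i
      · simpa using h2 j
      · simpa using h1 j
  rw [e, Measure.prod_prod, Measure.pi_pi, Measure.pi_pi, Fin.prod_univ_add, mul_comm]

theorem cross_mean_uniform_berry_esseen (K : ℝ) (hK : 1 < K) :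
    ∃ C : ℝ, 0 < C ∧
      ∀ (d m₁ m₂ : ℕ), 0 < m₁ → 0 < m₂ →
        ∀ P : Measure (Fin d → ℝ), LyapunovAssumption P 0 K →
          ∀ z : ℝ,
            |((Measure.pi fun _ : Fin (m₁ + m₂) => P)
                {ω | Tmean d m₁ m₂ ω ≤ z}).toReal - Φ z| ≤ C / Real.sqrt m₁ := by
  refine ⟨5100 * K ^ 3, by positivity, ?_⟩
  intro d m₁ m₂ hm₁ hm₂ P hP z
  have : IsProbabilityMeasure P := hP.1
  have hTm : Measurable (fun ω => Tmean d m₁ m₂ ω) := by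
    unfold Tmean studentized dot; fun_prop
  have hA : MeasurableSet {ω | Tmean d m₁ m₂ ω ≤ z} := measurableSet_le hTm measurable_const
  have happ : Measurable (fun p : (Fin m₂ → Fin d → ℝ) × (Fin m₁ → Fin d → ℝ) =>
      Fin.append p.2 p.1) := by
    rw [measurable_pi_iff]
    intro i
    refine Fin.addCases (fun j => ?_) (fun j => ?_) i
    · simp only [Fin.append_left]; fun_prop
    · simp only [Fin.append_right]; fun_prop
  set μ₁ := Measure.pi fun _ : Fin m₁ => P with hμ₁
  set μ₂ := Measure.pi fun _ : Fin m₂ => P with hμ₂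
  set B := (fun p : (Fin m₂ → Fin d → ℝ) × (Fin m₁ → Fin d → ℝ) =>
      Fin.append p.2 p.1) ⁻¹' {ω | Tmean d m₁ m₂ ω ≤ z} with hBdef
  have hB : MeasurableSet B := happ hA
  have e1 : ((Measure.pi fun _ : Fin (m₁ + m₂) => P) {ω | Tmean d m₁ m₂ ω ≤ z}).toReal
      = ∫ b, μ₁.real (Prod.mk b ⁻¹' B) ∂μ₂ := by
    rw [← pi_append P m₁ m₂, Measure.map_apply happ hA, Measure.prod_apply hB,
      ← integral_toReal (measurable_measure_prodMk_left hB).aemeasurable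
        (ae_of_all _ fun b => measure_lt_top _ _)]
    rfl
  have hFm : Measurable (fun b => μ₁.real (Prod.mk b ⁻¹' B)) :=
    (measurable_measure_prodMk_left hB).ennreal_toReal
  have hFi : Integrable (fun b => μ₁.real (Prod.mk b ⁻¹' B)) μ₂ :=
    Integrable.of_bound hFm.aestronglyMeasurable 1 (ae_of_all _ fun b => by
      rw [Real.norm_of_nonneg measureReal_nonneg]; exact measureReal_le_one)
  have e2 : ∫ b, μ₁.real (Prod.mk b ⁻¹' B) ∂μ₂ - Φ z
      = ∫ b, (μ₁.real (Prod.mk b ⁻¹' B) - Φ z) ∂μ₂ := by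
    rw [integral_sub hFi (integrable_const _)]
    simp
  rw [e1, e2, ← Real.norm_eq_abs]
  have hae : ∀ᵐ b ∂μ₂, ‖μ₁.real (Prod.mk b ⁻¹' B) - Φ z‖ ≤ 5100 * K ^ 3 / Real.sqrt m₁ := by
    filter_upwards [sigma_pos_ae P K hK hP m₂ hm₂] with b hb
    have := slice_bound P K hK hP _ hb m₁ hm₁ z
    rw [Real.norm_eq_abs]
    convert! this using 5
    ext a
    simp only [hBdef, Set.mem_preimage, Set.mem_ofPred_eq, Tmean, Fin.append_left, Fin.append_right]
  have := norm_integral_le_of_norm_le_const hae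
  simpa using this

end
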